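/- arXiv:math/0010270 — 4 statements merged into one kernel-verified Lean document; each statement's English description precedes it below -/
import Mathlib

section
/- Let ι : O → A be an injective homomorphism of Hopf algebras over ℂ, with O commutative. Then A, regarded as a left O-module via ι followed by left multiplication in A, is faithfully flat over O. -/
open TensorProduct

/-- An `R`-module `M` has flat dimension at most `n` if its character module has injective
dimension at most `n`. -/
def FlatDimLE (R : Type) [CommRing R] (n : ℕ) (M : Type) [AddCommGroup M] [Module R M] : Prop :=
  CategoryTheory.HasInjectiveDimensionLE (ModuleCat.of R (CharacterModule M)) n

namespace FlatDimLE

open CategoryTheory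

variable {R : Type} [CommRing R] {n : ℕ} {X Y Z : Type} [AddCommGroup X] [AddCommGroup Y]
  [AddCommGroup Z] [Module R X] [Module R Y] [Module R Z]

theorem zero_iff : FlatDimLE R 0 X ↔ Module.Flat R X := by
  rw [Module.Flat.iff_characterModule_injective, Module.injective_iff_injective_object,
    injective_iff_hasInjectiveDimensionLT_one]
  rfl

theorem mono {m : ℕ} (h : n ≤ m) (hX : FlatDimLE R n X) : FlatDimLE R m X := by
  have := hX
  unfold FlatDimLE at this
  exact hasInjectiveDimensionLT_of_ge _ (n + 1) (m + 1) (by lia)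

theorem of_retract (i : X →ₗ[R] Y) (r : Y →ₗ[R] X) (h : ∀ x, r (i x) = x)
    (hY : FlatDimLE R n Y) : FlatDimLE R n X := by
  have hri : r ∘ₗ i = LinearMap.id := LinearMap.ext h
  have := hY
  unfold FlatDimLE at this
  refine Retract.hasInjectiveDimensionLT (Y := ModuleCat.of R (CharacterModule Y))
    ⟨ModuleCat.ofHom (CharacterModule.dual r), ModuleCat.ofHom (CharacterModule.dual i), ?_⟩ _
  ext c x
  exact congrArg c (h x)

section ShortExact

variable {f : X →ₗ[R] Y} {g : Y →ₗ[R] Z} (hf : Function.Injective f)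
  (hfg : Function.Exact f g) (hg : Function.Surjective g)

include hf hfg hg

theorem exists_shortExact : ∃ S : ShortComplex (ModuleCat.{0} R), S.ShortExact ∧
    S.X₁ = ModuleCat.of R (CharacterModule Z) ∧ S.X₂ = ModuleCat.of R (CharacterModule Y) ∧
    S.X₃ = ModuleCat.of R (CharacterModule X) := by
  refine ⟨ShortComplex.mk (ModuleCat.ofHom (CharacterModule.dual g))
    (ModuleCat.ofHom (CharacterModule.dual f)) ?_, ?_, rfl, rfl, rfl⟩
  · ext c x
    change c (g (f x)) = 0
    rw [hfg.apply_apply_eq_zero, map_zero]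
  · refine ModuleCat.shortComplex_shortExact _ ?_ ?_ ?_
    · intro c
      refine ⟨fun hc ↦ ?_, ?_⟩
      · have hc' : ∀ x, c (f x) = 0 := fun x ↦ congr($hc x)
        let c' : Y →+ AddCircle (1 : ℚ) := c
        have hker : ∀ y y', g y = g y' → c y = c y' := by
          intro y y' h
          obtain ⟨x, hx⟩ := (hfg (y - y')).1 (by rw [map_sub, h, sub_self])
          have := hc' x
          rw [hx, map_sub, sub_eq_zero] at this
          exact this
        choose s hs using hg
        let d : CharacterModule Z := (
          { toFun := fun z ↦ c (s z)
            map_zero' := by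
              rw [hker (s 0) 0 (by rw [hs, map_zero]), map_zero]
            map_add' := fun z w ↦ by
              rw [← map_add]
              exact hker _ _ (by rw [map_add, hs, hs, hs]) } : Z →+ AddCircle (1 : ℚ))
        refine ⟨d, CharacterModule.ext _ fun y ↦ ?_⟩
        exact hker _ _ (hs _)
      · rintro ⟨d, rfl⟩
        refine CharacterModule.ext _ fun x ↦ ?_
        change d (g (f x)) = 0
        rw [hfg.apply_apply_eq_zero, map_zero]
    · exact CharacterModule.dual_injective_of_surjective g hg
    · exact CharacterModule.dual_surjective_of_injective f hf

theorem of_shortExact_right (hX : FlatDimLE R n X) (hY : FlatDimLE R (n + 1) Y) :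
    FlatDimLE R (n + 1) Z := by
  obtain ⟨S, hS, h₁, h₂, h₃⟩ := exists_shortExact hf hfg hg
  have := hS.hasInjectiveDimensionLT_X₁ (n + 1) (by rw [h₃]; exact hX) (by rw [h₂]; exact hY)
  rwa [h₁] at this

theorem of_shortExact_left (hY : FlatDimLE R n Y) (hZ : FlatDimLE R (n + 1) Z) :
    FlatDimLE R n X := by
  obtain ⟨S, hS, h₁, h₂, h₃⟩ := exists_shortExact hf hfg hg
  have := hS.hasInjectiveDimensionLT_X₃ (n + 1) (by rw [h₂]; exact hY) (by rw [h₁]; exact hZ)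
  rwa [h₃] at this

end ShortExact

end FlatDimLE

/-- The `k`-linear tensor product `X ⊗[k] Y` of two `O`-modules, with `O` acting through
`c : O →ₐ[k] O ⊗[k] O`. -/
def Diag {k O : Type} [Field k] [CommRing O] [Algebra k O] (_ : O →ₐ[k] O ⊗[k] O) (X Y : Type)
    [AddCommGroup X] [AddCommGroup Y] [Module k X] [Module k Y] : Type :=
  X ⊗[k] Y

namespace Diag

variable {k O : Type} [Field k] [CommRing O] [Algebra k O]

section Action

variable (k O) (X Y : Type) [AddCommGroup X] [AddCommGroup Y] [Module k X] [Module k Y]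
  [Module O X] [Module O Y] [IsScalarTower k O X] [IsScalarTower k O Y]

/-- The action of `O ⊗ O` on the tensor product of two `O`-modules. -/
noncomputable def act : O ⊗[k] O →ₐ[k] Module.End k (X ⊗[k] Y) :=
  (Module.endTensorEndAlgHom (R := k) (S := k) (A := k) (M := X) (N := Y)).comp
    (Algebra.TensorProduct.map (Algebra.lsmul k k X) (Algebra.lsmul k k Y))

variable {k O X Y}

@[simp]
theorem act_tmul (o p : O) (x : X) (y : Y) :
    act k O X Y (o ⊗ₜ p) (x ⊗ₜ y) = (o • x) ⊗ₜ (p • y) := rfl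

end Action

section Instances

variable (c : O →ₐ[k] O ⊗[k] O) (X Y : Type) [AddCommGroup X] [AddCommGroup Y] [Module k X]
  [Module k Y]

noncomputable instance : AddCommGroup (Diag c X Y) := inferInstanceAs (AddCommGroup (X ⊗[k] Y))

noncomputable instance : Module k (Diag c X Y) := inferInstanceAs (Module k (X ⊗[k] Y))

variable {X Y} in
/-- A pure tensor, as an element of `Diag c X Y`. -/
noncomputable def tmul (x : X) (y : Y) : Diag c X Y := x ⊗ₜ[k] y

variable {c X Y} in
@[elab_as_elim]
theorem induction_on {p : Diag c X Y → Prop} (z : Diag c X Y) (zero : p 0)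
    (tmul : ∀ x y, p (tmul c x y)) (add : ∀ s t, p s → p t → p (s + t)) : p z :=
  TensorProduct.induction_on z zero tmul add

variable [Module O X] [Module O Y] [IsScalarTower k O X] [IsScalarTower k O Y]

noncomputable instance : Module O (Diag c X Y) :=
  Module.compHom (X ⊗[k] Y) ((act k O X Y).comp c).toRingHom

variable {c X Y}

theorem smul_def (o : O) (z : Diag c X Y) : o • z = act k O X Y (c o) z := rfl

instance : IsScalarTower k O (Diag c X Y) where
  smul_assoc r o z := by
    rw [smul_def, smul_def, map_smul, map_smul]
    rfl

end Instances

section Lift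

variable {c : O →ₐ[k] O ⊗[k] O} {X Y Z : Type} [AddCommGroup X] [AddCommGroup Y] [Module k X]
  [Module k Y] [Module O X] [Module O Y] [IsScalarTower k O X] [IsScalarTower k O Y]
  [AddCommGroup Z] [Module k Z] [Module O Z]

/-- A `k`-linear map out of `X ⊗ Y` compatible with the actions of `O`. -/
noncomputable def lift (l : X ⊗[k] Y →ₗ[k] Z)
    (h : ∀ o x y, l (act k O X Y (c o) (x ⊗ₜ y)) = o • l (x ⊗ₜ y)) : Diag c X Y →ₗ[O] Z where
  toFun := l
  map_add' := map_add l
  map_smul' o z := by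
    change l (act k O X Y (c o) z) = o • l z
    induction z using TensorProduct.induction_on with
    | zero => simp
    | add s t hs ht =>
      refine Eq.trans ?_ ((congr($hs + $ht)).trans ?_)
      · rw [← map_add, ← map_add]
      · rw [← smul_add, ← map_add]
    | tmul x y => exact h o x y

end Lift

section Map

variable (c : O →ₐ[k] O ⊗[k] O) {X Y X' Y' X'' : Type} [AddCommGroup X] [AddCommGroup Y] [Module k X]
  [Module k Y] [Module O X] [Module O Y] [IsScalarTower k O X] [IsScalarTower k O Y]
  [AddCommGroup X'] [AddCommGroup Y'] [Module k X']
  [Module k Y'] [Module O X'] [Module O Y'] [IsScalarTower k O X'] [IsScalarTower k O Y']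
  [AddCommGroup X''] [Module k X''] [Module O X''] [IsScalarTower k O X'']

theorem act_map (f : X →ₗ[O] X') (g : Y →ₗ[O] Y') (t : O ⊗[k] O) (z : X ⊗[k] Y) :
    TensorProduct.map (f.restrictScalars k) (g.restrictScalars k) (act k O X Y t z) =
      act k O X' Y' t (TensorProduct.map (f.restrictScalars k) (g.restrictScalars k) z) := by
  induction t with
  | zero => simp
  | add s t hs ht => simp [hs, ht]
  | tmul o p =>
    induction z with
    | zero => simp
    | add s t hs ht => simp [hs, ht]
    | tmul x y => simp

/-- Functoriality of `Diag`. -/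
noncomputable def map (f : X →ₗ[O] X') (g : Y →ₗ[O] Y') : Diag c X Y →ₗ[O] Diag c X' Y' where
  toFun := TensorProduct.map (f.restrictScalars k) (g.restrictScalars k)
  map_add' := map_add (TensorProduct.map (f.restrictScalars k) (g.restrictScalars k))
  map_smul' o z := act_map f g (c o) z

theorem map_id_left_injective {f : X →ₗ[O] X'} (hf : Function.Injective f) :
    Function.Injective (map c f (LinearMap.id : Y →ₗ[O] Y)) :=
  Module.Flat.rTensor_preserves_injective_linearMap (M := Y) (f.restrictScalars k) hf

theorem map_id_left_surjective {f : X →ₗ[O] X'} (hf : Function.Surjective f) :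
    Function.Surjective (map c f (LinearMap.id : Y →ₗ[O] Y)) :=
  LinearMap.rTensor_surjective (Q := Y) (g := f.restrictScalars k) hf

theorem map_id_left_exact {f : X →ₗ[O] X'} {g : X' →ₗ[O] X''} (h : Function.Exact f g) :
    Function.Exact (map c f (LinearMap.id : Y →ₗ[O] Y)) (map c g LinearMap.id) :=
  Module.Flat.rTensor_exact (M := Y) (f := f.restrictScalars k) (g := g.restrictScalars k) h

end Map

section Exchange

variable (c c' : O →ₐ[k] O ⊗[k] O) (N F Y : Type) [AddCommGroup N] [AddCommGroup F]
  [AddCommGroup Y] [Module k N] [Module k F] [Module k Y] [Module O N] [Module O F] [Module O Y]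
  [IsScalarTower k O N] [IsScalarTower k O F] [IsScalarTower k O Y]

/-- The map `f ⊗ y ↦ f ⊗ (n ⊗ y)`. -/
noncomputable def exchangeAux (n : N) : F ⊗[k] Y →+ F ⊗[O] Diag c' N Y :=
  TensorProduct.liftAddHom
    { toFun := fun f ↦
        { toFun := fun y ↦ f ⊗ₜ[O] (show Diag c' N Y from n ⊗ₜ[k] y)
          map_zero' := by
            rw [TensorProduct.tmul_zero]
            exact TensorProduct.tmul_zero _ _
          map_add' := fun y y' ↦ by
            rw [TensorProduct.tmul_add]
            exact TensorProduct.tmul_add _ _ _ }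
      map_zero' := by
        ext y
        exact TensorProduct.zero_tmul _ _
      map_add' := fun f f' ↦ by
        ext y
        exact TensorProduct.add_tmul _ _ _ }
    (fun r f y ↦ by
      change (r • f) ⊗ₜ[O] (show Diag c' N Y from n ⊗ₜ[k] y) =
        f ⊗ₜ[O] (show Diag c' N Y from n ⊗ₜ[k] (r • y))
      rw [← algebraMap_smul O r f, TensorProduct.smul_tmul, algebraMap_smul]
      congr 1
      exact (TensorProduct.tmul_smul r n y).symm)

@[simp]
theorem exchangeAux_tmul (n : N) (f : F) (y : Y) :
    exchangeAux c' N F Y n (f ⊗ₜ y) = f ⊗ₜ[O] (show Diag c' N Y from n ⊗ₜ[k] y) := rfl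

theorem exchangeAux_act (n : N) (t : O ⊗[k] O) (f : F) (y : Y) :
    exchangeAux c' N F Y n (act k O F Y t (f ⊗ₜ y)) = f ⊗ₜ[O] (show Diag c' N Y from
      act k O N Y (Algebra.TensorProduct.productMap c' Algebra.TensorProduct.includeRight t)
        (n ⊗ₜ y)) := by
  induction t with
  | zero => 
    simp only [map_zero, LinearMap.zero_apply]
    exact (TensorProduct.tmul_zero _ _).symm
  | add s t hs ht =>
    simp only [map_add, LinearMap.add_apply, hs, ht]
    exact (TensorProduct.tmul_add _ _ _).symm
  | tmul o p =>
    rw [act_tmul, exchangeAux_tmul, TensorProduct.smul_tmul, smul_def]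
    congr 1
    simp only [Algebra.TensorProduct.productMap_apply_tmul, map_mul]
    simp
    rfl

theorem exchangeAux_zero : exchangeAux c' N F Y 0 = 0 := by
  ext z
  induction z with
  | zero => simp only [map_zero]
  | add s t hs ht => simp only [map_add, hs, ht]
  | tmul f y =>
    rw [exchangeAux_tmul, TensorProduct.zero_tmul]
    exact TensorProduct.tmul_zero _ _

theorem exchangeAux_add (n n' : N) :
    exchangeAux c' N F Y (n + n') = exchangeAux c' N F Y n + exchangeAux c' N F Y n' := by
  ext z
  induction z with
  | zero => simp only [map_zero]
  | add s t hs ht => simp only [map_add, hs, ht]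
  | tmul f y =>
    rw [exchangeAux_tmul, TensorProduct.add_tmul]
    exact TensorProduct.tmul_add _ _ _

variable {c c'} (h : ∀ o, Algebra.TensorProduct.productMap c' Algebra.TensorProduct.includeRight
  (c o) = o ⊗ₜ 1)

/-- The exchange map `n ⊗ (f ⊗ y) ↦ f ⊗ (n ⊗ y)`. -/
noncomputable def exchange : N ⊗[O] Diag c F Y →+ F ⊗[O] Diag c' N Y :=
  TensorProduct.liftAddHom
    { toFun := fun n ↦ (exchangeAux c' N F Y n : F ⊗[k] Y →+ _)
      map_zero' := exchangeAux_zero c' N F Y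
      map_add' := exchangeAux_add c' N F Y }
    (fun o n z ↦ by
      change exchangeAux c' N F Y (o • n) z = exchangeAux c' N F Y n (act k O F Y (c o) z)
      induction z using TensorProduct.induction_on with
      | zero => simp
      | add s t hs ht =>
        rw [map_add, map_add, map_add, hs, ht]
      | tmul f y =>
        rw [exchangeAux_act, h, act_tmul, one_smul, exchangeAux_tmul])

variable (h' : ∀ o, Algebra.TensorProduct.productMap c Algebra.TensorProduct.includeRight
  (c' o) = o ⊗ₜ 1)

theorem exchange_exchange (z : N ⊗[O] Diag c F Y) :
    exchange F N Y h' (exchange N F Y h z) = z := by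
  induction z with
  | zero => simp
  | add s t hs ht => rw [map_add, map_add, hs, ht]
  | tmul n w =>
    induction w using Diag.induction_on with
    | zero => rw [TensorProduct.tmul_zero, map_zero, map_zero]
    | add s t hs ht => rw [TensorProduct.tmul_add, map_add, map_add, hs, ht]
    | tmul f y => rfl

theorem exchange_naturality {N' : Type} [AddCommGroup N'] [Module k N'] [Module O N']
    [IsScalarTower k O N'] (g : N →ₗ[O] N') (z : N ⊗[O] Diag c F Y) :
    exchange N' F Y h (g.rTensor _ z) =
      (map c' g (LinearMap.id : Y →ₗ[O] Y)).lTensor F (exchange N F Y h z) := by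
  induction z with
  | zero => simp
  | add s t hs ht => rw [map_add, map_add, map_add, map_add, hs, ht]
  | tmul n w =>
    induction w using Diag.induction_on with
    | zero => simp only [TensorProduct.tmul_zero, map_zero]
    | add s t hs ht => simp only [TensorProduct.tmul_add, map_add, hs, ht]
    | tmul f y => rfl

include h h' in
theorem flat [Module.Flat O F] : Module.Flat O (Diag c F Y) := by
  rw [Module.Flat.iff_rTensor_injective']
  intro I
  have h₁ : Function.Injective ((map c' I.subtype (LinearMap.id : Y →ₗ[O] Y)).lTensor F) :=
    Module.Flat.lTensor_preserves_injective_linearMap _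
      (map_id_left_injective c' I.subtype_injective)
  have h₂ : Function.Injective (exchange I F Y h) :=
    Function.LeftInverse.injective (exchange_exchange I F Y h h')
  intro z w hzw
  apply h₂
  apply h₁
  rw [← exchange_naturality, ← exchange_naturality, hzw]

include h h' in
theorem flatDimLE (n : ℕ) (X : Type) [AddCommGroup X] [Module k X] [Module O X]
    [IsScalarTower k O X] (hX : FlatDimLE O n X) : FlatDimLE O n (Diag c X Y) := by
  induction n generalizing X with
  | zero =>
    rw [FlatDimLE.zero_iff] at hX ⊢
    exact flat X Y h h'
  | succ n ih =>
    let g : (X →₀ O) →ₗ[O] X := Finsupp.linearCombination O id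
    have hg : Function.Surjective g := Finsupp.linearCombination_id_surjective O X
    have hex : Function.Exact g.ker.subtype g := LinearMap.exact_subtype_ker_map g
    have hL : FlatDimLE O 0 (X →₀ O) := FlatDimLE.zero_iff.2 inferInstance
    have hK : FlatDimLE O n g.ker :=
      FlatDimLE.of_shortExact_left g.ker.subtype_injective hex hg (hL.mono n.zero_le) hX
    refine FlatDimLE.of_shortExact_right (map_id_left_injective c (Y := Y) g.ker.subtype_injective)
      (map_id_left_exact c hex) (map_id_left_surjective c hg) (ih _ hK) ?_
    refine FlatDimLE.mono (Nat.zero_le _) (FlatDimLE.zero_iff.2 ?_)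
    exact flat _ Y h h'

end Exchange

end Diag

section ScalarConvolution

open Coalgebra

variable {k C M : Type} [Field k] [AddCommGroup C] [Module k C] [Coalgebra k C] [AddCommGroup M]
  [Module k M] (φ : C ⊗[k] C →ₗ[k] M) {m : M} (hφ : ∀ x, φ (comul x) = counit (R := k) x • m)
include hφ

theorem lTensor_assoc_rTensor_comul (c : C) :
    φ.lTensor C (TensorProduct.assoc k C C C (comul.rTensor C (comul c))) = c ⊗ₜ m := by
  have h : φ ∘ₗ comul = LinearMap.toSpanSingleton k M m ∘ₗ counit := LinearMap.ext hφ
  rw [coassoc_apply, ← LinearMap.comp_apply, ← LinearMap.lTensor_comp, h, LinearMap.lTensor_comp,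
    LinearMap.comp_apply, lTensor_counit_comul]
  simp

theorem rTensor_assoc_symm_lTensor_comul (c : C) :
    φ.rTensor C ((TensorProduct.assoc k C C C).symm (comul.lTensor C (comul c))) = m ⊗ₜ c := by
  have h : φ ∘ₗ comul = LinearMap.toSpanSingleton k M m ∘ₗ counit := LinearMap.ext hφ
  rw [coassoc_symm_apply, ← LinearMap.comp_apply, ← LinearMap.rTensor_comp, h,
    LinearMap.rTensor_comp, LinearMap.comp_apply, rTensor_counit_comul]
  simp

end ScalarConvolution

namespace Diag

open Coalgebra HopfAlgebra

variable {k O : Type} [Field k] [CommRing O] [HopfAlgebra k O]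

variable (k O) in
/-- `o ↦ ∑ o₁ ⊗ S o₂`. -/
noncomputable def comulAntipode : O →ₐ[k] O ⊗[k] O :=
  (Algebra.TensorProduct.map (AlgHom.id k O) (antipodeAlgHom k O)).comp (Bialgebra.comulAlgHom k O)

variable (k O) in
/-- `o ↦ ∑ o₂ ⊗ o₁`. -/
noncomputable def comulSwap : O →ₐ[k] O ⊗[k] O :=
  (Algebra.TensorProduct.comm k O O).toAlgHom.comp (Bialgebra.comulAlgHom k O)

variable (k O) in
/-- `o ↦ ∑ o₂ ⊗ S o₁`. -/
noncomputable def comulSwapAntipode : O →ₐ[k] O ⊗[k] O :=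
  (Algebra.TensorProduct.map (AlgHom.id k O) (antipodeAlgHom k O)).comp (comulSwap k O)

theorem comulAntipode_apply (o : O) :
    comulAntipode k O o = (antipode k).lTensor O (comul o) := rfl

theorem comulSwap_apply (o : O) : comulSwap k O o = TensorProduct.comm k O O (comul o) := rfl

theorem comulSwapAntipode_apply (o : O) : comulSwapAntipode k O o =
    (antipode k).lTensor O (TensorProduct.comm k O O (comul o)) := rfl

theorem productMap_comulAntipode_comul (o : O) :
    Algebra.TensorProduct.productMap (comulAntipode k O) Algebra.TensorProduct.includeRight
      (Bialgebra.comulAlgHom k O o) = o ⊗ₜ 1 := by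
  let φ : O ⊗[k] O →ₗ[k] O := LinearMap.mul' k O ∘ₗ (antipode k).rTensor O
  have hφ (x : O) : φ (comul x) = counit (R := k) x • 1 := by
    simp [φ, Algebra.algebraMap_eq_smul_one]
  rw [← lTensor_assoc_rTensor_comul φ hφ, Bialgebra.comulAlgHom_apply]
  generalize comul (R := k) o = t
  induction t with
  | zero => simp
  | add s t hs ht => simp only [map_add, hs, ht]
  | tmul a b =>
    simp only [Algebra.TensorProduct.productMap_apply_tmul,
      LinearMap.rTensor_tmul, comulAntipode_apply]
    generalize comul (R := k) a = t
    induction t with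
    | zero => simp
    | add s t hs ht =>
      simp only [map_add, add_mul, hs, ht, TensorProduct.add_tmul]
    | tmul x y => simp [φ, mul_comm]

theorem productMap_comul_comulAntipode (o : O) :
    Algebra.TensorProduct.productMap (Bialgebra.comulAlgHom k O) Algebra.TensorProduct.includeRight
      (comulAntipode k O o) = o ⊗ₜ 1 := by
  let φ : O ⊗[k] O →ₗ[k] O := LinearMap.mul' k O ∘ₗ (antipode k).lTensor O
  have hφ (x : O) : φ (comul x) = counit (R := k) x • 1 := by
    simp [φ, Algebra.algebraMap_eq_smul_one]
  rw [← lTensor_assoc_rTensor_comul φ hφ, comulAntipode_apply]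
  generalize comul (R := k) o = t
  induction t with
  | zero => simp
  | add s t hs ht => simp only [map_add, hs, ht]
  | tmul a b =>
    simp only [Algebra.TensorProduct.productMap_apply_tmul,
      LinearMap.lTensor_tmul, LinearMap.rTensor_tmul, Bialgebra.comulAlgHom_apply]
    generalize comul (R := k) a = t
    induction t with
    | zero => simp
    | add s t hs ht =>
      simp only [map_add, add_mul, hs, ht, TensorProduct.add_tmul]
    | tmul x y => simp [φ]

theorem productMap_comulSwapAntipode_comulSwap (o : O) :
    Algebra.TensorProduct.productMap (comulSwapAntipode k O) Algebra.TensorProduct.includeRight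
      (comulSwap k O o) = o ⊗ₜ 1 := by
  let φ : O ⊗[k] O →ₗ[k] O := LinearMap.mul' k O ∘ₗ (antipode k).lTensor O
  have hφ (x : O) : φ (comul x) = counit (R := k) x • 1 := by
    simp [φ, Algebra.algebraMap_eq_smul_one]
  have := congr(TensorProduct.comm k O O $(rTensor_assoc_symm_lTensor_comul φ hφ o))
  rw [TensorProduct.comm_tmul] at this
  rw [← this, comulSwap_apply]
  generalize comul (R := k) o = t
  induction t with
  | zero => simp
  | add s t hs ht => simp only [map_add, hs, ht]
  | tmul a b =>
    simp only [TensorProduct.comm_tmul, Algebra.TensorProduct.productMap_apply_tmul,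
      LinearMap.lTensor_tmul, comulSwapAntipode_apply]
    generalize comul (R := k) b = t
    induction t with
    | zero => simp
    | add s t hs ht =>
      simp only [map_add, add_mul, hs, ht, TensorProduct.tmul_add]
    | tmul x y => simp [φ, mul_comm]

theorem productMap_comulSwap_comulSwapAntipode (o : O) :
    Algebra.TensorProduct.productMap (comulSwap k O) Algebra.TensorProduct.includeRight
      (comulSwapAntipode k O o) = o ⊗ₜ 1 := by
  let φ : O ⊗[k] O →ₗ[k] O := LinearMap.mul' k O ∘ₗ (antipode k).rTensor O
  have hφ (x : O) : φ (comul x) = counit (R := k) x • 1 := by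
    simp [φ, Algebra.algebraMap_eq_smul_one]
  have := congr(TensorProduct.comm k O O $(rTensor_assoc_symm_lTensor_comul φ hφ o))
  rw [TensorProduct.comm_tmul] at this
  rw [← this, comulSwapAntipode_apply]
  generalize comul (R := k) o = t
  induction t with
  | zero => simp
  | add s t hs ht => simp only [map_add, hs, ht]
  | tmul a b =>
    simp only [TensorProduct.comm_tmul, Algebra.TensorProduct.productMap_apply_tmul,
      LinearMap.lTensor_tmul, comulSwap_apply]
    generalize comul (R := k) b = t
    induction t with
    | zero => simp
    | add s t hs ht =>
      simp only [map_add, add_mul, hs, ht, TensorProduct.tmul_add]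
    | tmul x y => simp [φ, mul_comm]

variable {n : ℕ} (X Y : Type) [AddCommGroup X] [AddCommGroup Y] [Module k X] [Module k Y]
  [Module O X] [Module O Y] [IsScalarTower k O X] [IsScalarTower k O Y]

theorem flatDimLE_comul_left (hX : FlatDimLE O n X) :
    FlatDimLE O n (Diag (Bialgebra.comulAlgHom k O) X Y) :=
  flatDimLE Y productMap_comulAntipode_comul productMap_comul_comulAntipode n X hX

theorem act_comm (t : O ⊗[k] O) (z : X ⊗[k] Y) :
    TensorProduct.comm k X Y (act k O X Y t z) =
      act k O Y X (TensorProduct.comm k O O t) (TensorProduct.comm k X Y z) := by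
  induction t with
  | zero => simp
  | add s t hs ht => simp [hs, ht]
  | tmul o p =>
    induction z with
    | zero => simp
    | add s t hs ht => simp [hs, ht]
    | tmul x y => simp

/-- Exchanging the two factors intertwines the diagonal action and its opposite. -/
noncomputable def swap : Diag (Bialgebra.comulAlgHom k O) X Y →ₗ[O] Diag (comulSwap k O) Y X where
  toFun := TensorProduct.comm k X Y
  map_add' := map_add (TensorProduct.comm k X Y)
  map_smul' o z := act_comm X Y (comul o) z

/-- Exchanging the two factors intertwines the diagonal action and its opposite. -/
noncomputable def swapSymm :
    Diag (comulSwap k O) Y X →ₗ[O] Diag (Bialgebra.comulAlgHom k O) X Y where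
  toFun := TensorProduct.comm k Y X
  map_add' := map_add (TensorProduct.comm k Y X)
  map_smul' o z := by
    refine (act_comm Y X (comulSwap k O o) z).trans ?_
    have h : TensorProduct.comm k O O (comulSwap k O o) = comul o :=
      (TensorProduct.comm k O O).symm_apply_apply (comul o)
    rw [h]
    rfl

theorem flatDimLE_comul_right (hX : FlatDimLE O n X) :
    FlatDimLE O n (Diag (Bialgebra.comulAlgHom k O) Y X) :=
  FlatDimLE.of_retract (swap Y X) (swapSymm Y X)
    (fun z ↦ (TensorProduct.comm k Y X).symm_apply_apply z)
    (flatDimLE Y productMap_comulSwapAntipode_comulSwap productMap_comulSwap_comulSwapAntipode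
      n X hX)

end Diag

namespace HopfModule

open Coalgebra HopfAlgebra

variable {k O A : Type} [Field k] [CommRing O] [HopfAlgebra k O] [Ring A] [HopfAlgebra k A]
  [Module O A] [IsScalarTower k O A]

/-- `x ⊗ y ↦ Δ(x) (1 ⊗ y)`. -/
noncomputable def galoisMap (k A : Type) [Field k] [Ring A] [HopfAlgebra k A] :
    A ⊗[k] A →ₗ[k] A ⊗[k] A :=
  LinearMap.mul' k (A ⊗[k] A) ∘ₗ
    TensorProduct.map comul (Algebra.TensorProduct.includeRight (R := k) (A := A)).toLinearMap

@[simp]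
theorem galoisMap_tmul (x y : A) : galoisMap k A (x ⊗ₜ y) = comul x * 1 ⊗ₜ[k] y := rfl

theorem galoisMap_lTensor_antipode_comul (x y : A) :
    galoisMap k A ((LinearMap.mulRight k y ∘ₗ antipode k).lTensor A (comul x)) = x ⊗ₜ y := by
  let φ : A ⊗[k] A →ₗ[k] A := LinearMap.mulRight k y ∘ₗ LinearMap.mul' k A ∘ₗ (antipode k).lTensor A
  have hφ (x : A) : φ (comul x) = counit (R := k) x • y := by
    simp [φ, Algebra.algebraMap_eq_smul_one]
  rw [← lTensor_assoc_rTensor_comul φ hφ]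
  generalize comul (R := k) x = t
  induction t with
  | zero => simp
  | add s t hs ht => simp only [map_add, hs, ht]
  | tmul a b =>
    rw [LinearMap.lTensor_tmul, galoisMap_tmul, LinearMap.rTensor_tmul]
    generalize comul (R := k) a = t
    induction t with
    | zero => simp
    | add s t hs ht => simp only [map_add, add_mul, hs, ht, TensorProduct.add_tmul]
    | tmul x y => simp [φ, mul_assoc]

variable {ι : O →ₐc[k] A} (hsmul : ∀ (o : O) (a : A), o • a = ι o * a)
include hsmul

theorem act_eq_mul (t : O ⊗[k] O) (z : A ⊗[k] A) :
    Diag.act k O A A t z = TensorProduct.map (ι : O →ₗ[k] A) (ι : O →ₗ[k] A) t * z := by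
  induction t with
  | zero => simp
  | add s t hs ht => simp only [map_add, LinearMap.add_apply, add_mul, hs, ht]
  | tmul o p =>
    induction z with
    | zero => simp
    | add s t hs ht => simp only [map_add, mul_add, hs, ht]
    | tmul x y => simp [hsmul]

theorem comul_smul (o : O) (a : A) :
    comul (R := k) (o • a) = Diag.act k O A A (comul o) (comul a) := by
  rw [act_eq_mul hsmul, hsmul, Bialgebra.comul_mul]
  congr 1
  exact (CoalgHomClass.map_comp_comul_apply ι o).symm

omit [IsScalarTower k O A] in
theorem counit_smul (o : O) (a : A) :
    counit (R := k) (o • a) = counit (R := k) o * counit (R := k) a := by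
  rw [hsmul, Bialgebra.counit_mul]
  congr 1
  exact CoalgHomClass.counit_comp_apply ι o

variable (k) in
/-- The comultiplication of `A` as an `O`-linear map. -/
noncomputable def comulLin : A →ₗ[O] Diag (Bialgebra.comulAlgHom k O) A A where
  toFun := comul (R := k)
  map_add' := map_add (comul (R := k))
  map_smul' := comul_smul hsmul

variable (k A) in
/-- `x ⊗ a ↦ ε(a) x` as an `O`-linear map. -/
noncomputable def idCounit (X : Type) [AddCommGroup X] [Module k X] [Module O X]
    [IsScalarTower k O X] : Diag (Bialgebra.comulAlgHom k O) X A →ₗ[O] X :=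
  Diag.lift ((TensorProduct.rid k X).toLinearMap ∘ₗ (counit (R := k) (A := A)).lTensor X) (by
    intro o x a
    have h := congr((LinearMap.lsmul k X (counit (R := k) a))
      ((LinearMap.toSpanSingleton O X x).restrictScalars k
        (TensorProduct.rid k O $(lTensor_counit_comul (R := k) o))))
    simp only [rid_tmul, one_smul] at h
    refine Eq.trans ?_ (h.trans ?_)
    · rw [Bialgebra.comulAlgHom_apply]
      generalize comul (R := k) o = t
      induction t with
      | zero => simp
      | add s t hs ht => simp only [map_add, hs, ht, LinearMap.add_apply]
      | tmul p q =>
        simp [counit_smul hsmul, smul_smul]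
    · simp [smul_algebra_smul_comm])

end HopfModule

namespace HopfModule

open Coalgebra HopfAlgebra

variable {k O A : Type} [Field k] [CommRing O] [HopfAlgebra k O] [Ring A] [HopfAlgebra k A]
  [Module O A] [IsScalarTower k O A]
variable {ι : O →ₐc[k] A} (hsmul : ∀ (o : O) (a : A), o • a = ι o * a)
include hsmul

/-- The map `x ⊗ y ↦ Δ(x) (1 ⊗ S y)` sends `s a₁ ⊗ a₂` to `Δ(s) (a ⊗ 1)`. -/
theorem act_comul_tmul_one_eq_zero {s : O} {a : A}
    (h : Diag.act k O A A (s ⊗ₜ 1) (comul a) = 0) :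
    Diag.act k O A A (comul s) (a ⊗ₜ 1) = 0 := by
  have key (z : A ⊗[k] A) :
      galoisMap k A ((antipode k).lTensor A (Diag.act k O A A (s ⊗ₜ 1) z)) =
        Diag.act k O A A (comul s) (galoisMap k A ((antipode k).lTensor A z)) := by
    induction z with
    | zero => simp
    | add s t hs ht => simp only [map_add, hs, ht]
    | tmul x y =>
      rw [Diag.act_tmul, LinearMap.lTensor_tmul, galoisMap_tmul, comul_smul hsmul,
        act_eq_mul hsmul, act_eq_mul hsmul, one_smul, LinearMap.lTensor_tmul, galoisMap_tmul,
        mul_assoc]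
  have h₁ : galoisMap k A ((antipode k).lTensor A (comul a)) = a ⊗ₜ 1 := by
    simpa using galoisMap_lTensor_antipode_comul (k := k) a 1
  rw [← h₁, ← key, h, map_zero, map_zero]

theorem eq_zero_of_act_comul_eq_zero (hι : Function.Injective ι) {s : O} (hs : s ≠ 0) {a : A}
    (h : Diag.act k O A A (s ⊗ₜ 1) (comul a) = 0) : a = 0 := by
  have h₁ := act_comul_tmul_one_eq_zero hsmul h
  let α : O →ₗ[k] A := (LinearMap.toSpanSingleton O A a).restrictScalars k
  have h₂ : α.rTensor O (comul s) = 0 := by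
    have hinj : Function.Injective ((ι : O →ₗ[k] A).lTensor A) :=
      Module.Flat.lTensor_preserves_injective_linearMap _ hι
    apply hinj
    rw [map_zero, ← h₁]
    generalize comul (R := k) s = t
    induction t with
    | zero => simp
    | add s t hs ht => simp only [map_add, hs, ht, LinearMap.add_apply]
    | tmul p q => simp [α, hsmul]
  let ψ : A ⊗[k] O →ₗ[k] A := TensorProduct.lift
    (((Algebra.lsmul k k A : O →ₐ[k] _).toLinearMap ∘ₗ antipode k).flip)
  let φ : O ⊗[k] O →ₗ[k] A := α ∘ₗ LinearMap.mul' k O ∘ₗ (antipode k).lTensor O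
  have hφ (x : O) : φ (comul x) = counit (R := k) x • a := by
    simp [φ, α]
  have h₃ := rTensor_assoc_symm_lTensor_comul φ hφ s
  have h₄ : ψ.rTensor O ((TensorProduct.assoc k A O O).symm
      ((comul (R := k)).lTensor A (α.rTensor O (comul s)))) = a ⊗ₜ s := by
    rw [← h₃]
    generalize comul (R := k) s = t
    induction t with
    | zero => simp
    | add s t hs ht => simp only [map_add, hs, ht]
    | tmul p q =>
      simp only [LinearMap.rTensor_tmul, LinearMap.lTensor_tmul]
      generalize comul (R := k) q = t
      induction t with
      | zero => simp
      | add s t hs ht => simp only [map_add, hs, ht, TensorProduct.tmul_add]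
      | tmul x y => simp [φ, α, ψ, smul_smul, mul_comm]
  rw [h₂, map_zero, map_zero, map_zero] at h₄
  by_contra ha
  obtain ⟨f, hf⟩ := Module.Projective.exists_dual_ne_zero k ha
  have h₅ := congr(TensorProduct.lid k O (f.rTensor O $h₄))
  simp only [map_zero, LinearMap.rTensor_tmul, lid_tmul] at h₅
  exact hs ((smul_eq_zero.1 h₅.symm).resolve_left hf)

end HopfModule

namespace HopfModule

open Coalgebra HopfAlgebra

variable {k O A : Type} [Field k] [CommRing O] [HopfAlgebra k O] [Ring A] [HopfAlgebra k A]
  [Module O A] [IsScalarTower k O A]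
variable {ι : O →ₐc[k] A} (hsmul : ∀ (o : O) (a : A), o • a = ι o * a)
include hsmul

theorem idCounit_tmul (X : Type) [AddCommGroup X] [Module k X] [Module O X]
    [IsScalarTower k O X] (x : X) (a : A) :
    idCounit k A hsmul X (Diag.tmul _ x a) = counit (R := k) a • x := by
  change (TensorProduct.rid k X).toLinearMap ((counit (R := k) (A := A)).lTensor X (x ⊗ₜ a)) = _
  simp

theorem idCounit_comulLin (a : A) : idCounit k A hsmul A (comulLin k hsmul a) = a := by
  change (TensorProduct.rid k A).toLinearMap
    ((counit (R := k) (A := A)).lTensor A (comul a)) = _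
  rw [lTensor_counit_comul]
  simp

/-- If every element of the kernel of `π : A → B` is killed by a nonzero element of `O`, where the
nonzero elements in question form a submonoid, then `a ↦ π(a₁) ⊗ a₂` is injective. -/
theorem map_comulLin_injective (hι : Function.Injective ι) {B : Type} [AddCommGroup B] [Module k B]
    [Module O B] [IsScalarTower k O B] (π : A →ₗ[O] B) (S : Submonoid O) (hS : (0 : O) ∉ S)
    (hπ : ∀ a, π a = 0 → ∃ s ∈ S, s • a = 0) :
    Function.Injective (Diag.map _ π LinearMap.id ∘ₗ comulLin k hsmul) := by
  rw [← LinearMap.ker_eq_bot, LinearMap.ker_eq_bot']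
  intro a ha
  have hex : Function.Exact (π.ker.subtype.restrictScalars k) (π.restrictScalars k) :=
    LinearMap.exact_subtype_ker_map π
  obtain ⟨w, hw⟩ := (Module.Flat.rTensor_exact A hex (comul a)).1 ha
  have key (w : π.ker ⊗[k] A) : ∃ s ∈ S, Diag.act k O A A (s ⊗ₜ 1)
      ((π.ker.subtype.restrictScalars k).rTensor A w) = 0 := by
    induction w with
    | zero => exact ⟨1, S.one_mem, by simp⟩
    | tmul x y =>
      obtain ⟨s, hs, h⟩ := hπ x x.2
      exact ⟨s, hs, by simp [h]⟩
    | add x y hx hy =>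
      obtain ⟨s, hs, h⟩ := hx
      obtain ⟨t, ht, h'⟩ := hy
      refine ⟨s * t, S.mul_mem hs ht, ?_⟩
      have h₁ : (s * t) ⊗ₜ[k] (1 : O) = (s ⊗ₜ 1) * (t ⊗ₜ 1) := by simp
      have h₂ : (s * t) ⊗ₜ[k] (1 : O) = (t ⊗ₜ 1) * (s ⊗ₜ 1) := by simp [mul_comm]
      rw [map_add, map_add]
      nth_rw 1 [h₂]
      rw [h₁, map_mul, map_mul, Module.End.mul_apply, Module.End.mul_apply, h, h', map_zero,
        map_zero, add_zero]
  obtain ⟨s, hs, h⟩ := key w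
  rw [hw] at h
  exact eq_zero_of_act_comul_eq_zero hsmul hι (fun h ↦ hS (h ▸ hs)) h

theorem flatDimLE_of_succ {d : ℕ} (hA : FlatDimLE O (d + 1) A) {B : Type} [AddCommGroup B]
    [Module k B] [Module O B] [IsScalarTower k O B] [Module.Flat O B] (π : A →ₗ[O] B)
    (hinj : Function.Injective (Diag.map _ π LinearMap.id ∘ₗ comulLin k hsmul)) :
    FlatDimLE O d A := by
  set j := Diag.map _ π LinearMap.id ∘ₗ comulLin k hsmul with hj
  have hflat (X Y : Type) [AddCommGroup X] [AddCommGroup Y] [Module k X] [Module k Y]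
      [Module O X] [Module O Y] [IsScalarTower k O X] [IsScalarTower k O Y] [Module.Flat O X] :
      Module.Flat O (Diag (Bialgebra.comulAlgHom k O) X Y) :=
    FlatDimLE.zero_iff.1 (Diag.flatDimLE_comul_left X Y (FlatDimLE.zero_iff.2 inferInstance))
  have := hflat B A
  refine FlatDimLE.of_retract (comulLin k hsmul) (idCounit k A hsmul A) (idCounit_comulLin hsmul) ?_
  refine FlatDimLE.of_shortExact_left
    (Diag.map_id_left_injective (Bialgebra.comulAlgHom k O) (Y := A) hinj)
    (Diag.map_id_left_exact _ (LinearMap.exact_map_mkQ_range j))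
    (Diag.map_id_left_surjective _ (Submodule.mkQ_surjective _))
    (FlatDimLE.mono d.zero_le (FlatDimLE.zero_iff.2 (hflat _ _)))
    (Diag.flatDimLE_comul_right _ _ hA)

theorem flat_of_flatDimLE {d : ℕ} (hA : FlatDimLE O d A) {B : Type} [AddCommGroup B]
    [Module k B] [Module O B] [IsScalarTower k O B] [Module.Flat O B] (π : A →ₗ[O] B)
    (hinj : Function.Injective (Diag.map _ π LinearMap.id ∘ₗ comulLin k hsmul)) :
    Module.Flat O A := by
  induction d with
  | zero => exact FlatDimLE.zero_iff.1 hA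
  | succ d ih => exact ih (flatDimLE_of_succ hsmul hA π hinj)

omit hsmul in
/-- If a nonzero module with trivial action has finite flat dimension, so does `A`. -/
theorem flatDimLE_of_trivial {d : ℕ} {X : Type} [AddCommGroup X] [Module k X] [Module O X]
    [IsScalarTower k O X] [Nontrivial X] (htriv : ∀ (o : O) (x : X), o • x = counit (R := k) o • x)
    (hX : FlatDimLE O d X) : FlatDimLE O d A := by
  obtain ⟨x, hx⟩ := exists_ne (0 : X)
  obtain ⟨f, hf⟩ := Module.Projective.exists_dual_eq_one k hx
  have hact (o : O) (x : X) (a : A) :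
      Diag.act k O X A (comul o) (x ⊗ₜ a) = x ⊗ₜ (o • a) := by
    have h := congr((TensorProduct.mk k X A x)
      ((LinearMap.toSpanSingleton O A a).restrictScalars k
        (TensorProduct.lid k O $(rTensor_counit_comul (R := k) o))))
    simp only [lid_tmul, one_smul] at h
    refine Eq.trans ?_ h
    generalize comul (R := k) o = t
    induction t with
    | zero => simp
    | add s t hs ht => simp only [map_add, hs, ht, LinearMap.add_apply]
    | tmul p q => simp [htriv, TensorProduct.smul_tmul]
  let i : A →ₗ[O] Diag (Bialgebra.comulAlgHom k O) X A :=
    { toFun := TensorProduct.mk k X A x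
      map_add' := map_add (TensorProduct.mk k X A x)
      map_smul' o a := (hact o x a).symm }
  refine FlatDimLE.of_retract i
    (Diag.lift ((TensorProduct.lid k A).toLinearMap ∘ₗ f.rTensor A) fun o x a ↦ ?_) (fun a ↦ ?_)
    (Diag.flatDimLE_comul_left X A hX)
  · rw [Bialgebra.comulAlgHom_apply, hact]
    simp [smul_algebra_smul_comm]
  · change TensorProduct.lid k A (f.rTensor A (x ⊗ₜ a)) = a
    simp [hf]

theorem subsingleton_of_flat [Module.Flat O A] (hι : Function.Injective ι) (N : Type)
    [AddCommGroup N] [Module O N] [Subsingleton (N ⊗[O] A)] : Subsingleton N := by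
  let ιl : O →ₗ[O] A := LinearMap.toSpanSingleton O A 1
  have hιl (o : O) : ιl o = ι o := by simp [ιl, hsmul]
  have hιl_inj : Function.Injective ιl := fun o p h ↦ hι (by rw [← hιl, h, hιl])
  have hflat : Module.Flat O (Diag (Bialgebra.comulAlgHom k O) (A ⧸ ιl.range) A) :=
    FlatDimLE.zero_iff.1 (Diag.flatDimLE_comul_right A _ (FlatDimLE.zero_iff.2 inferInstance))
  have hinj := LinearMap.lTensor_injective_of_exact_of_flat _
    (Diag.map_id_left_surjective (Bialgebra.comulAlgHom k O) (Y := A) ιl.range.mkQ_surjective)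
    (Diag.map _ ιl LinearMap.id) (Diag.map_id_left_injective _ hιl_inj)
    (Diag.map_id_left_exact _ (LinearMap.exact_map_mkQ_range ιl)) N
  have hzero : ∀ (n : N) (z : A ⊗[k] A),
      n ⊗ₜ[O] (show Diag (Bialgebra.comulAlgHom k O) A A from galoisMap k A z) = 0 := by
    intro n z
    induction z with
    | zero =>
      rw [map_zero]
      exact TensorProduct.tmul_zero _ _
    | add s t hs ht =>
      rw [map_add]
      exact (TensorProduct.tmul_add _ _ _).trans (by rw [hs, ht, add_zero])
    | tmul x y =>
      let β : A →ₗ[O] Diag (Bialgebra.comulAlgHom k O) A A :=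
        { toFun := fun x ↦ galoisMap k A (x ⊗ₜ y)
          map_add' := fun x x' ↦ by
            rw [TensorProduct.add_tmul]
            exact map_add _ _ _
          map_smul' := fun o x ↦ by
            rw [galoisMap_tmul, galoisMap_tmul, comul_smul hsmul, act_eq_mul hsmul, mul_assoc,
              ← act_eq_mul hsmul]
            rfl }
      exact (LinearMap.lTensor_tmul N β n x).symm.trans
        ((congrArg _ (Subsingleton.elim _ 0)).trans (map_zero _))
  have hsub : Subsingleton (N ⊗[O] Diag (Bialgebra.comulAlgHom k O) A A) := by
    refine subsingleton_of_forall_eq 0 fun w ↦ ?_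
    induction w with
    | zero => rfl
    | add s t hs ht => rw [hs, ht, add_zero]
    | tmul n z =>
      induction z using Diag.induction_on with
      | zero => exact TensorProduct.tmul_zero _ _
      | add s t hs ht => rw [TensorProduct.tmul_add, hs, ht, add_zero]
      | tmul x y =>
        rw [← hzero n ((LinearMap.mulRight k y ∘ₗ antipode k).lTensor A (comul x)),
          galoisMap_lTensor_antipode_comul]
        rfl
  have hsub' := hinj.subsingleton
  have hsurj : Function.Surjective (idCounit k A hsmul O) := fun o ↦
    ⟨Diag.tmul _ o 1, by rw [idCounit_tmul, Bialgebra.counit_one, one_smul]⟩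
  have := (LinearMap.lTensor_surjective N hsurj).subsingleton
  exact (TensorProduct.rid O N).symm.injective.subsingleton

end HopfModule

section Coordinates

open IsLocalRing

variable {k R : Type} [Field k] [CharZero k] [CommRing R] [Algebra k R]

theorem Derivation.isNilpotent_apply (D : Derivation k R R) {y : R} (hy : IsNilpotent y) :
    IsNilpotent (D y) := by
  have key : ∀ m l : ℕ, y ^ m * D y ^ l = 0 → IsNilpotent (D y) := by
    intro m
    induction m with
    | zero => exact fun l h ↦ ⟨l, by simpa using h⟩
    | succ m ih =>
      intro l h
      refine ih (l + 2) ?_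
      have h₁ : D (y ^ (m + 1) * D y ^ l) * D y = 0 := by rw [h, map_zero, zero_mul]
      rw [Derivation.leibniz, Derivation.leibniz_pow,
        Derivation.leibniz_pow] at h₁
      simp only [Nat.add_sub_cancel, smul_eq_mul, nsmul_eq_mul] at h₁
      have h₂ : ((m + 1 : ℕ) : R) * (y ^ m * D y ^ (l + 2)) = 0 := by
        rcases l with _ | l
        · simp at h₁ ⊢
          linear_combination h₁
        · simp only [Nat.add_sub_cancel] at h₁
          linear_combination h₁ - (l + 1 : ℕ) * D (D y) * h
      have h₃ : IsUnit ((m + 1 : ℕ) : R) := by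
        rw [← _root_.map_natCast (algebraMap k R)]
        exact (IsUnit.mk0 _ (Nat.cast_ne_zero.2 m.succ_ne_zero)).map _
      exact (h₃.mul_right_eq_zero).1 h₂
  obtain ⟨n, hn⟩ := hy
  exact key n 0 (by simpa using hn)

variable [IsLocalRing R] [IsNoetherianRing R] {n : ℕ} {x : Fin n → R}
  {D : Fin n → Derivation k R R} (hD : ∀ i j, D i (x j) = if i = j then 1 else 0)

/-- The ideal generated by the first `i` coordinates. -/
def coordIdeal (x : Fin n → R) (i : ℕ) : Ideal R := Ideal.span (x '' {j | j.val < i})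

omit [CharZero k] [Algebra k R] [IsLocalRing R] [IsNoetherianRing R] in
theorem coordIdeal_succ (i : Fin n) :
    coordIdeal x (i + 1) = coordIdeal x i ⊔ Ideal.span {x i} := by
  have : {j : Fin n | j.val < i + 1} = {j : Fin n | j.val < i} ∪ {i} := by
    ext j
    simp [Fin.ext_iff]
    lia
  rw [coordIdeal, this, Set.image_union, Set.image_singleton, Ideal.span_union]
  rfl

include hD

omit [CharZero k] [IsLocalRing R] [IsNoetherianRing R] in
theorem derivation_mem_coordIdeal (i : Fin n) {y : R} (hy : y ∈ coordIdeal x i) :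
    D i y ∈ coordIdeal x i := by
  induction hy using Submodule.span_induction with
  | mem y h =>
    obtain ⟨j, hj, rfl⟩ := h
    rw [hD, if_neg (by rintro rfl; simp at hj)]
    exact zero_mem _
  | zero => simp
  | add y z _ _ hy hz => rw [map_add]; exact add_mem hy hz
  | smul a y hy' hy =>
    rw [smul_eq_mul, Derivation.leibniz]
    exact add_mem (Ideal.mul_mem_left _ _ hy) (Ideal.mul_mem_right _ _ hy')

theorem mem_coordIdeal_of_mul_mem (hx : Ideal.span (Set.range x) = maximalIdeal R)
    (i : Fin n) {y : R} (hy : x i * y ∈ coordIdeal x i) : y ∈ coordIdeal x i := by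
  have key (m : ℕ) : ∃ z, y - x i ^ m * z ∈ coordIdeal x i := by
    induction m with
    | zero => exact ⟨y, by simp⟩
    | succ m ih =>
      obtain ⟨z, hz⟩ := ih
      have h₁ : x i ^ (m + 1) * z ∈ coordIdeal x i := by
        have := sub_mem hy (Ideal.mul_mem_left _ (x i) hz)
        convert this using 1
        ring
      have h₂ := derivation_mem_coordIdeal hD i h₁
      rw [Derivation.leibniz, Derivation.leibniz_pow, hD, if_pos rfl] at h₂
      simp only [Nat.add_sub_cancel, smul_eq_mul, nsmul_eq_mul, mul_one] at h₂
      have h₃ : algebraMap k R (m + 1 : ℕ)⁻¹ * ((m + 1 : ℕ) : R) = 1 := by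
        rw [← map_natCast (algebraMap k R), ← map_mul,
          inv_mul_cancel₀ (Nat.cast_ne_zero.2 m.succ_ne_zero), map_one]
      refine ⟨- algebraMap k R (m + 1 : ℕ)⁻¹ * D i z, ?_⟩
      have := add_mem hz (Ideal.mul_mem_left _ (algebraMap k R (m + 1 : ℕ)⁻¹) h₂)
      convert this using 1
      linear_combination -(z * x i ^ m) * h₃
  have hmem (m : ℕ) : (Ideal.Quotient.mk (coordIdeal x i) y) ∈
      ((maximalIdeal R) ^ m • ⊤ : Submodule R (R ⧸ coordIdeal x i)) := by
    obtain ⟨z, hz⟩ := key m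
    rw [(Ideal.Quotient.eq).2 hz]
    have : Ideal.Quotient.mk (coordIdeal x i) (x i ^ m * z) =
        (x i ^ m) • Ideal.Quotient.mk (coordIdeal x i) z := rfl
    rw [this]
    refine Submodule.smul_mem_smul (Ideal.pow_mem_pow ?_ m) trivial
    rw [← hx]
    exact Ideal.subset_span ⟨i, rfl⟩
  have hbot := Ideal.iInf_pow_smul_eq_bot_of_isLocalRing (M := R ⧸ coordIdeal x i)
    (maximalIdeal R) (Ideal.IsPrime.ne_top inferInstance)
  have : Ideal.Quotient.mk (coordIdeal x i) y ∈
    (⨅ m : ℕ, (maximalIdeal R) ^ m • ⊤ : Submodule R (R ⧸ coordIdeal x i)) :=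
    (Submodule.mem_iInf _).2 hmem
  rw [hbot] at this
  exact Ideal.Quotient.eq_zero_iff_mem.1 this

theorem flatDimLE_coordIdeal (hx : Ideal.span (Set.range x) = maximalIdeal R)
    (O : Type) [CommRing O] [Algebra O R] [Module.Flat O R] (i : ℕ) (hi : i ≤ n) :
    FlatDimLE O i (R ⧸ coordIdeal x i) := by
  induction i with
  | zero =>
    have : coordIdeal x 0 = ⊥ := by simp [coordIdeal]
    rw [this]
    exact FlatDimLE.zero_iff.2 (Module.Flat.of_linearEquiv
      ((AlgEquiv.quotientBot O R).toLinearEquiv))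
  | succ i ih =>
    have hFD := ih (by lia)
    have hle : coordIdeal x i ≤ coordIdeal x (i + 1) :=
      le_sup_left.trans_eq (coordIdeal_succ ⟨i, hi⟩).symm
    let f : (R ⧸ coordIdeal x i) →ₗ[O] (R ⧸ coordIdeal x i) :=
      (LinearMap.lsmul R _ (x ⟨i, hi⟩)).restrictScalars O
    let g : (R ⧸ coordIdeal x i) →ₗ[O] (R ⧸ coordIdeal x (i + 1)) :=
      (Ideal.Quotient.factorₐ O hle).toLinearMap
    refine FlatDimLE.of_shortExact_right (f := f) (g := g) ?_ ?_ ?_ hFD (hFD.mono (by lia))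
    · rw [← LinearMap.ker_eq_bot, LinearMap.ker_eq_bot']
      intro y hy
      obtain ⟨y, rfl⟩ := Ideal.Quotient.mk_surjective y
      exact Ideal.Quotient.eq_zero_iff_mem.2
        (mem_coordIdeal_of_mul_mem hD hx ⟨i, hi⟩ (Ideal.Quotient.eq_zero_iff_mem.1 hy))
    · intro y
      obtain ⟨y, rfl⟩ := Ideal.Quotient.mk_surjective y
      constructor
      · intro h
        have h' : y ∈ coordIdeal x (i + 1) := Ideal.Quotient.eq_zero_iff_mem.1 h
        rw [coordIdeal_succ ⟨i, hi⟩, Submodule.mem_sup] at h'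
        obtain ⟨w, hw, v, hv, rfl⟩ := h'
        obtain ⟨z, rfl⟩ := Ideal.mem_span_singleton'.1 hv
        refine ⟨Ideal.Quotient.mk _ z, ?_⟩
        change Ideal.Quotient.mk _ (x ⟨i, hi⟩ * z) = _
        rw [Ideal.Quotient.eq]
        convert neg_mem hw using 1
        ring
      · rintro ⟨z, hz⟩
        obtain ⟨z, rfl⟩ := Ideal.Quotient.mk_surjective z
        rw [← hz]
        refine Ideal.Quotient.eq_zero_iff_mem.2 ?_
        rw [coordIdeal_succ ⟨i, hi⟩]
        exact Ideal.mul_mem_right _ _ (Ideal.mem_sup_right (Ideal.mem_span_singleton_self _))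
    · exact Ideal.Quotient.factor_surjective hle

omit [CharZero k] [IsNoetherianRing R] in
theorem euler_sub_mem (hx : Ideal.span (Set.range x) = maximalIdeal R) (a : ℕ) {y : R}
    (hy : y ∈ maximalIdeal R ^ a) : ∑ i, x i * D i y - a * y ∈ maximalIdeal R ^ (a + 1) := by
  have hxm (i) : x i ∈ maximalIdeal R := hx ▸ Ideal.subset_span ⟨i, rfl⟩
  have hE (y : R) : ∑ i, x i * D i y ∈ maximalIdeal R :=
    sum_mem fun i _ ↦ Ideal.mul_mem_right _ _ (hxm i)
  have hmul (r s : R) : ∑ i, x i * D i (r * s) =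
      r * ∑ i, x i * D i s + s * ∑ i, x i * D i r := by
    simp only [Derivation.leibniz, smul_eq_mul, Finset.mul_sum, ← Finset.sum_add_distrib]
    exact Finset.sum_congr rfl fun i _ ↦ by ring
  have hone {r : R} (hr : r ∈ maximalIdeal R) :
      ∑ i, x i * D i r - r ∈ maximalIdeal R ^ 2 := by
    rw [← hx] at hr
    induction hr using Submodule.span_induction with
    | mem r h =>
      obtain ⟨j, rfl⟩ := h
      simp [hD]
    | zero => simp
    | add r s _ _ hr hs =>
      convert add_mem hr hs using 1
      simp only [map_add, mul_add, Finset.sum_add_distrib]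
      ring
    | smul c r hr' hr =>
      replace hr' : r ∈ maximalIdeal R := hx ▸ hr'
      have := add_mem (Ideal.mul_mem_left _ c hr)
        (pow_two (maximalIdeal R) ▸ Ideal.mul_mem_mul hr' (hE c))
      convert this using 1
      rw [smul_eq_mul, hmul]
      ring
  induction a generalizing y with
  | zero => simpa using hE y
  | succ a ih =>
    rw [pow_succ'] at hy
    induction hy using Submodule.mul_induction_on' with
    | mem_mul_mem r hr s hs =>
      have h₁ := Ideal.mul_mem_mul hr (ih hs)
      have h₂ := Ideal.mul_mem_mul (hone hr) hs
      rw [← pow_succ'] at h₁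
      rw [← pow_add, add_comm 2] at h₂
      convert add_mem h₁ h₂ using 1
      rw [hmul]
      push_cast
      ring
    | add r _ s _ hr hs =>
      convert add_mem hr hs using 1
      simp only [map_add, mul_add, Finset.sum_add_distrib]
      ring

theorem isReduced_of_coordinates (hx : Ideal.span (Set.range x) = maximalIdeal R) :
    IsReduced R := by
  have hxm (i) : x i ∈ maximalIdeal R := hx ▸ Ideal.subset_span ⟨i, rfl⟩
  have key (a : ℕ) : ∀ y : R, IsNilpotent y → y ∈ maximalIdeal R ^ (a + 1) := by
    induction a with
    | zero =>
      intro y hy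
      rw [zero_add, pow_one]
      exact (IsLocalRing.mem_maximalIdeal _).2 fun h ↦ h.not_isNilpotent hy
    | succ a ih =>
      intro y hy
      have h₁ := euler_sub_mem hD hx (a + 1) (ih y hy)
      have h₂ : ∑ i, x i * D i y ∈ maximalIdeal R ^ (a + 1 + 1) := by
        refine sum_mem fun i _ ↦ ?_
        rw [pow_succ' _ (a + 1)]
        exact Ideal.mul_mem_mul (hxm i) (ih _ ((D i).isNilpotent_apply hy))
      have h₃ : algebraMap k R (a + 1 : ℕ)⁻¹ * ((a + 1 : ℕ) : R) = 1 := by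
        rw [← map_natCast (algebraMap k R), ← map_mul,
          inv_mul_cancel₀ (Nat.cast_ne_zero.2 a.succ_ne_zero), map_one]
      have := Ideal.mul_mem_left _ (algebraMap k R (a + 1 : ℕ)⁻¹) (sub_mem h₂ h₁)
      convert this using 1
      linear_combination -y * h₃
  refine ⟨fun y hy ↦ ?_⟩
  have hbot := Ideal.iInf_pow_eq_bot_of_isLocalRing (maximalIdeal R)
    (Ideal.IsPrime.ne_top inferInstance)
  have : y ∈ ⨅ m : ℕ, maximalIdeal R ^ m :=
    (Submodule.mem_iInf _).2 fun m ↦ Ideal.pow_le_pow_right m.le_succ (key m y hy)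
  rwa [hbot] at this

end Coordinates

section CounitIdeal

open Coalgebra

variable (k O : Type) [Field k] [CommRing O] [Bialgebra k O]

/-- The augmentation ideal of a commutative bialgebra. -/
def counitIdeal : Ideal O := RingHom.ker (Bialgebra.counitAlgHom k O)

variable {k O}

theorem mem_counitIdeal {o : O} : o ∈ counitIdeal k O ↔ counit (R := k) o = 0 := Iff.rfl

theorem sub_counit_mem (o : O) : o - algebraMap k O (counit (R := k) o) ∈ counitIdeal k O := by
  rw [mem_counitIdeal, map_sub, Bialgebra.counit_algebraMap, sub_self]

instance : (counitIdeal k O).IsMaximal :=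
  RingHom.ker_isMaximal_of_surjective _ fun c ↦
    ⟨algebraMap k O c, Bialgebra.counit_algebraMap c⟩

theorem smul_cotangent_counitIdeal (o : O) (v : (counitIdeal k O).Cotangent) :
    o • v = counit (R := k) o • v := by
  have h := Ideal.Cotangent.smul_eq_zero_of_mem (sub_counit_mem (k := k) o) v
  rwa [sub_smul, sub_eq_zero, algebraMap_smul] at h

instance [IsNoetherianRing O] : Module.Finite k (counitIdeal k O).Cotangent := by
  have := Module.Finite.of_surjective _ (counitIdeal k O).toCotangent_surjective
  obtain ⟨s, hs⟩ := Module.Finite.fg_top (R := O) (M := (counitIdeal k O).Cotangent)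
  refine ⟨s, eq_top_iff.2 fun v _ ↦ ?_⟩
  have hv : v ∈ Submodule.span O (s : Set (counitIdeal k O).Cotangent) := hs ▸ trivial
  induction hv using Submodule.span_induction with
  | mem v h => exact Submodule.subset_span h
  | zero => exact zero_mem _
  | add v w _ _ hv hw => exact add_mem (hv trivial) (hw trivial)
  | smul o v _ hv =>
    rw [smul_cotangent_counitIdeal]
    exact Submodule.smul_mem _ _ (hv trivial)

/-- The left invariant derivation attached to a point derivation at the counit. -/
noncomputable def invariantDerivation (δ : O →ₗ[k] k)
    (hδ : ∀ f g, δ (f * g) = counit (R := k) f * δ g + counit (R := k) g * δ f) :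
    Derivation k O O :=
  Derivation.mk' ((TensorProduct.rid k O).toLinearMap ∘ₗ δ.lTensor O ∘ₗ comul) fun a b ↦ by
    have key (s t : O ⊗[k] O) : TensorProduct.rid k O (δ.lTensor O (s * t)) =
        TensorProduct.rid k O ((counit (R := k) (A := O)).lTensor O s) *
          TensorProduct.rid k O (δ.lTensor O t) +
        TensorProduct.rid k O ((counit (R := k) (A := O)).lTensor O t) *
          TensorProduct.rid k O (δ.lTensor O s) := by
      induction s with
      | zero => simp
      | add s s' hs hs' => simp only [add_mul, mul_add, map_add, hs, hs']; ring
      | tmul f g =>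
        induction t with
        | zero => simp
        | add t t' ht ht' => simp only [add_mul, mul_add, map_add, ht, ht']; ring
        | tmul f' g' =>
          simp only [Algebra.TensorProduct.tmul_mul_tmul, LinearMap.lTensor_tmul,
            TensorProduct.rid_tmul, hδ, add_smul, smul_mul_smul_comm, mul_comm f' f,
            mul_comm (counit g')]
    simpa [Bialgebra.comul_mul] using key (comul a) (comul b)

theorem counit_invariantDerivation (δ : O →ₗ[k] k) (hδ) (a : O) :
    counit (R := k) (invariantDerivation δ hδ a) = δ a := by
  have key (t : O ⊗[k] O) : counit (R := k) (TensorProduct.rid k O (δ.lTensor O t)) =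
      δ (TensorProduct.lid k O ((counit (R := k) (A := O)).rTensor O t)) := by
    induction t with
    | zero => simp
    | add s t hs ht => simp only [map_add, hs, ht]
    | tmul f g => simp [mul_comm]
  exact (key (comul a)).trans (by simp)

theorem exists_coordinates [IsNoetherianRing O] : ∃ (n : ℕ) (x : Fin n → O)
    (D : Fin n → Derivation k O O), (∀ i, x i ∈ counitIdeal k O) ∧
    (∀ i j, counit (R := k) (D i (x j)) = if i = j then 1 else 0) ∧
    counitIdeal k O ≤ Ideal.span (Set.range x) ⊔ counitIdeal k O ^ 2 := by
  let m := counitIdeal k O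
  let b := Module.finBasis k m.Cotangent
  choose x hx using fun i ↦ m.toCotangent_surjective (b i)
  let q : O →ₗ[k] m := LinearMap.codRestrict (m.restrictScalars k)
    (LinearMap.id - Algebra.linearMap k O ∘ₗ counit) sub_counit_mem
  have hq (f : O) : (q f : O) = f - algebraMap k O (counit (R := k) f) := rfl
  let τ : m →ₗ[k] m.Cotangent := m.toCotangent.restrictScalars k
  let δ (i) : O →ₗ[k] k := b.coord i ∘ₗ τ ∘ₗ q
  have hτ (f g : O) : τ (q (f * g)) =
      counit (R := k) f • τ (q g) + counit (R := k) g • τ (q f) := by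
    rw [← τ.map_smul, ← τ.map_smul, ← τ.map_add]
    refine m.toCotangent_eq.2 ?_
    have := Ideal.mul_mem_mul (sub_counit_mem (k := k) f) (sub_counit_mem (k := k) g)
    rw [← pow_two] at this
    convert this using 1
    change (f * g - algebraMap k O (counit (R := k) (f * g))) -
      (counit (R := k) f • (g - algebraMap k O (counit (R := k) g)) +
        counit (R := k) g • (f - algebraMap k O (counit (R := k) f))) = _
    simp only [Bialgebra.counit_mul, map_mul, Algebra.smul_def]
    ring
  have hδ (i) (f g : O) : δ i (f * g) =
      counit (R := k) f * δ i g + counit (R := k) g * δ i f := by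
    change b.coord i (τ (q (f * g))) = _
    rw [hτ, map_add, map_smul, map_smul]
    rfl
  refine ⟨_, fun i ↦ x i, fun i ↦ invariantDerivation (δ i) (hδ i), fun i ↦ (x i).2,
    fun i j ↦ ?_, fun y hy ↦ ?_⟩
  · rw [counit_invariantDerivation]
    have : q (x j) = x j := by
      ext
      rw [hq, mem_counitIdeal.1 (x j).2, map_zero, sub_zero]
    change b.coord i (m.toCotangent (q (x j))) = _
    rw [this, hx, b.coord_apply, b.repr_self, Finsupp.single_apply]
    simp only [eq_comm]
  · let c := b.repr (m.toCotangent ⟨y, hy⟩)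
    have h : m.toCotangent ⟨y, hy⟩ = m.toCotangent (∑ i, algebraMap k O (c i) • x i) := by
      rw [map_sum]
      simp only [map_smul, hx]
      simp only [algebraMap_smul]
      exact (b.sum_repr _).symm
    rw [Ideal.toCotangent_eq] at h
    rw [← sub_add_cancel y (∑ i, algebraMap k O (c i) * x i), add_comm]
    refine Submodule.add_mem_sup (sum_mem fun i _ ↦ ?_) ?_
    · exact Ideal.mul_mem_left _ _ (Ideal.subset_span ⟨i, rfl⟩)
    · convert h
      simp only [AddSubmonoidClass.coe_finsetSum, Submodule.coe_smul, smul_eq_mul]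
end CounitIdeal

theorem Derivation.exists_extension_isLocalization {k O : Type} [CommRing k] [CommRing O]
    [Algebra k O] (R : Type) [CommRing R] [Algebra O R] [Algebra k R] [IsScalarTower k O R]
    (M : Submonoid O) [IsLocalization M R] (D : Derivation k O O) :
    ∃ D' : Derivation k R R, ∀ a, D' (algebraMap O R a) = algebraMap O R (D a) := by
  have := Algebra.FormallyEtale.of_isLocalization (Rₘ := R) M
  let f : R ⊗[O] Ω[O⁄k] →ₗ[R] R :=
    LinearMap.liftBaseChange R (Algebra.linearMap O R ∘ₗ D.liftKaehlerDifferential)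
  refine ⟨(f ∘ₗ (KaehlerDifferential.tensorKaehlerEquivOfFormallyEtale k O
    R).symm.toLinearMap).compDer (KaehlerDifferential.D k R), fun a ↦ ?_⟩
  change f ((KaehlerDifferential.tensorKaehlerEquivOfFormallyEtale k O R).symm
    (KaehlerDifferential.D k R (algebraMap O R a))) = _
  rw [KaehlerDifferential.tensorKaehlerEquivOfFormallyEtale_symm_D_algebraMap]
  simp [f]

section LocalCoordinates

open Coalgebra IsLocalRing

variable {k O : Type} [Field k] [CommRing O] [Bialgebra k O] [IsNoetherianRing O]

theorem exists_localization_coordinates : ∃ (n : ℕ)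
    (x : Fin n → Localization.AtPrime (counitIdeal k O))
    (D : Fin n → Derivation k (Localization.AtPrime (counitIdeal k O))
      (Localization.AtPrime (counitIdeal k O))),
    (∀ i j, D i (x j) = if i = j then 1 else 0) ∧
    Ideal.span (Set.range x) = maximalIdeal (Localization.AtPrime (counitIdeal k O)) := by
  obtain ⟨n, x, D, hx, hD, hle⟩ := exists_coordinates (k := k) (O := O)
  let R := Localization.AtPrime (counitIdeal k O)
  choose D' hD' using fun i ↦
    (D i).exists_extension_isLocalization R (counitIdeal k O).primeCompl
  let y (i) : R := algebraMap O R (x i)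
  have hmap : (counitIdeal k O).map (algebraMap O R) = maximalIdeal R :=
    Localization.AtPrime.map_eq_maximalIdeal
  have hmem {a : O} (ha : a ∈ counitIdeal k O) : algebraMap O R a ∈ maximalIdeal R :=
    hmap ▸ Ideal.mem_map_of_mem _ ha
  let A : Matrix (Fin n) (Fin n) R := fun i j ↦ D' i (y j)
  have hA : IsUnit A.det := by
    rw [← isUnit_map_iff (residue R), RingHom.map_det]
    have : (residue R).mapMatrix A = 1 := by
      ext i j
      have h : algebraMap O R (D i (x j) - algebraMap k O (counit (R := k) (D i (x j)))) ∈
        maximalIdeal R := hmem (sub_counit_mem _)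
      rw [map_sub, ← residue_eq_zero_iff, map_sub, sub_eq_zero, hD] at h
      change residue R (D' i (y j)) = _
      rw [hD', h, Matrix.one_apply]
      split_ifs <;> simp
    rw [this, Matrix.det_one]
    exact isUnit_one
  refine ⟨n, y, fun i ↦ ∑ l, A⁻¹ i l • D' l, fun i j ↦ ?_, le_antisymm ?_ ?_⟩
  · have := congrFun (congrFun (Matrix.nonsing_inv_mul A hA) i) j
    rw [Matrix.mul_apply, Matrix.one_apply] at this
    rw [← this]
    change Derivation.coeFnAddMonoidHom (∑ l, A⁻¹ i l • D' l) (y j) = _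
    rw [map_sum, Finset.sum_apply]
    rfl
  · rw [Ideal.span_le]
    rintro _ ⟨i, rfl⟩
    exact hmem (hx i)
  · refine Submodule.le_of_le_smul_of_le_jacobson_bot (I := maximalIdeal R)
      (IsNoetherian.noetherian _) (IsLocalRing.maximalIdeal_le_jacobson _) ?_
    have := Ideal.map_mono (f := algebraMap O R) hle
    rw [hmap, Ideal.map_sup, Ideal.map_span, Ideal.map_pow, hmap, pow_two, ← Set.range_comp] at this
    exact this

end LocalCoordinates

namespace HopfModule

open Coalgebra IsLocalRing

variable {k O A : Type} [Field k] [CommRing O] [HopfAlgebra k O] [Ring A] [HopfAlgebra k A]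
  [Module O A] [IsScalarTower k O A]
variable {ι : O →ₐc[k] A} (hsmul : ∀ (o : O) (a : A), o • a = ι o * a)
include hsmul

theorem flat_of_isNoetherianRing [CharZero k] [IsNoetherianRing O]
    (hι : Function.Injective ι) : Module.Flat O A := by
  obtain ⟨n, x, D, hD, hx⟩ := exists_localization_coordinates (k := k) (O := O)
  let m := counitIdeal k O
  let R := Localization.AtPrime m
  have : Module.Flat O R := IsLocalization.flat R m.primeCompl
  have htop : coordIdeal x n = maximalIdeal R := by
    rw [← hx, coordIdeal]
    congr 1
    ext
    simp
  have hFD : FlatDimLE O n A := by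
    have h := flatDimLE_coordIdeal hD hx O n le_rfl
    rw [htop] at h
    have : Nontrivial (R ⧸ maximalIdeal R) :=
      Ideal.Quotient.nontrivial_iff.2 (Ideal.IsPrime.ne_top inferInstance)
    refine flatDimLE_of_trivial (k := k) (X := R ⧸ maximalIdeal R) (fun o y ↦ ?_) h
    rw [← algebraMap_smul O (counit (R := k) o) y, ← sub_eq_zero, ← sub_smul,
      ← algebraMap_smul R, Algebra.smul_def]
    refine mul_eq_zero_of_left (Ideal.Quotient.eq_zero_iff_mem.2 ?_) _
    rw [← Localization.AtPrime.map_eq_maximalIdeal]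
    exact Ideal.mem_map_of_mem _ (sub_counit_mem _)
  have hred : IsReduced R := isReduced_of_coordinates hD hx
  obtain ⟨p, hp, hpm⟩ := Ideal.exists_minimalPrimes_le (bot_le : (⊥ : Ideal O) ≤ m)
  have := Ideal.IsMinimalPrime.isPrime hp
  let K := Localization.AtPrime p
  have hann (a : O) (ha : a ∈ p) : ∃ u ∉ p, u * a = 0 := by
    obtain ⟨t, ht, n, hn⟩ : ∃ t ∉ p, ∃ n : ℕ, t * a ^ n = 0 := by
      have hs := IsLocalization.subsingleton_primeSpectrum_of_mem_minimalPrimes p hp K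
      obtain ⟨n, hn⟩ : IsNilpotent (algebraMap O K a) := by
        refine nilpotent_iff_mem_prime.2 fun J hJ ↦ ?_
        have : J = maximalIdeal K := congrArg PrimeSpectrum.asIdeal
          (Subsingleton.elim (⟨J, hJ⟩ : PrimeSpectrum K) (closedPoint K))
        rw [this, ← Localization.AtPrime.map_eq_maximalIdeal]
        exact Ideal.mem_map_of_mem _ ha
      rw [← map_pow] at hn
      obtain ⟨t, ht⟩ := (IsLocalization.map_eq_zero_iff p.primeCompl K _).1 hn
      exact ⟨t, t.2, n, ht⟩
    have h : IsNilpotent (algebraMap O R (t * a)) := by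
      refine ⟨n + 1, ?_⟩
      have : (t * a) ^ (n + 1) = t ^ n * a * (t * a ^ n) := by ring
      rw [← map_pow, this, hn, mul_zero, map_zero]
    obtain ⟨u, hu⟩ := (IsLocalization.map_eq_zero_iff m.primeCompl R _).1 h.eq_zero
    refine ⟨u * t, fun h ↦ ?_, by rw [mul_assoc, hu]⟩
    exact (Ideal.IsPrime.mem_or_mem inferInstance h).elim (fun h ↦ u.2 (hpm h)) ht
  have hK : IsField K := by
    rw [IsLocalRing.isField_iff_maximalIdeal_eq, eq_bot_iff,
      ← Localization.AtPrime.map_eq_maximalIdeal, Ideal.map_le_iff_le_comap]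
    intro a ha
    obtain ⟨u, hu, hua⟩ := hann a ha
    exact (IsLocalization.map_eq_zero_iff p.primeCompl K a).2 ⟨⟨u, hu⟩, hua⟩
  let := hK.toField
  have : Module.Flat O K := IsLocalization.flat K p.primeCompl
  have : Module.Flat O (K ⊗[O] A) := Module.Flat.trans O K _
  let π : A →ₗ[O] K ⊗[O] A := TensorProduct.mk O K A 1
  refine flat_of_flatDimLE hsmul hFD π
    (map_comulLin_injective hsmul hι π p.primeCompl (fun h ↦ h p.zero_mem) fun a ha ↦ ?_)
  obtain ⟨s, hs⟩ := (IsLocalizedModule.eq_zero_iff p.primeCompl π).1 ha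
  exact ⟨s, s.2, hs⟩

end HopfModule

section MatrixCoefficients

open Coalgebra

variable {k O : Type} [Field k] [AddCommGroup O] [Module k O] [Coalgebra k O]

theorem comul_rid_lTensor (φ : O →ₗ[k] k) (t : O ⊗[k] O) :
    comul (R := k) (TensorProduct.rid k O (φ.lTensor O t)) =
      ((TensorProduct.rid k O).toLinearMap ∘ₗ φ.lTensor O).lTensor O
        (TensorProduct.assoc k O O O ((comul (R := k) (A := O)).rTensor O t)) := by
  induction t with
  | zero => simp
  | add s t hs ht => simp only [map_add, hs, ht]
  | tmul x y =>
    have (w : O ⊗[k] O) : ((TensorProduct.rid k O).toLinearMap ∘ₗ φ.lTensor O).lTensor O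
        (TensorProduct.assoc k O O O (w ⊗ₜ y)) = φ y • w := by
      induction w with
      | zero => simp
      | add s t hs ht => simp only [add_tmul, map_add, hs, ht, smul_add]
      | tmul a b => simp
    simp [this]

/-- Every element of a coalgebra lies in a finite-dimensional right subcomodule. -/
theorem exists_finiteDimensional_subcomodule (o : O) : ∃ V : Submodule k O,
    Module.Finite k V ∧ o ∈ V ∧
    ∀ v ∈ V, comul (R := k) v ∈ LinearMap.range (V.subtype.rTensor O) := by
  let e := Module.Basis.ofVectorSpace k O
  obtain ⟨a, ha⟩ := TensorProduct.eq_repr_basis_right e (comul (R := k) o)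
  let V := Submodule.span k (Set.range a)
  have hmem (i) : a i ∈ V := Submodule.subset_span ⟨i, rfl⟩
  have hrange (G : O →ₗ[k] O) :
      G.lTensor O (comul o) ∈ LinearMap.range (V.subtype.rTensor O) := by
    rw [← ha, Finsupp.sum, map_sum]
    exact sum_mem fun i _ ↦ ⟨⟨a i, hmem i⟩ ⊗ₜ G (e i), by simp⟩
  have hcoord (i) : a i = TensorProduct.rid k O ((e.coord i).lTensor O (comul o)) := by
    classical
    rw [← ha, Finsupp.sum, map_sum, map_sum]
    simp only [LinearMap.lTensor_tmul, TensorProduct.rid_tmul, Module.Basis.coord_apply,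
      Module.Basis.repr_self, Finsupp.single_apply, ite_smul, one_smul, zero_smul,
      Finset.sum_ite_eq']
    simp +contextual [eq_comm]
  refine ⟨V, FiniteDimensional.span_of_finite k a.finite_range, ?_, fun v hv ↦ ?_⟩
  · have h := congrArg (TensorProduct.rid k O) (lTensor_counit_comul (R := k) o)
    rw [← ha, Finsupp.sum, map_sum, map_sum, TensorProduct.rid_tmul, one_smul] at h
    rw [← h]
    exact sum_mem fun i _ ↦ by simpa using V.smul_mem _ (hmem i)
  · induction hv using Submodule.span_induction with
    | mem v h =>
      obtain ⟨i, rfl⟩ := h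
      rw [hcoord, comul_rid_lTensor, coassoc_apply, ← LinearMap.lTensor_comp_apply]
      exact hrange _
    | zero => simp
    | add v w _ _ hv hw => rw [map_add]; exact add_mem hv hw
    | smul r v _ hv => rw [map_smul]; exact Submodule.smul_mem _ _ hv

/-- Every element of a coalgebra is a linear combination of the coefficients of a
finite-dimensional matrix corepresentation. -/
theorem exists_matrix_coefficients (o : O) : ∃ (n : ℕ) (c : Matrix (Fin n) (Fin n) O),
    (∀ i j, comul (R := k) (c i j) = ∑ l, c i l ⊗ₜ c l j) ∧
    (∀ i j, counit (R := k) (c i j) = if i = j then 1 else 0) ∧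
    o ∈ Submodule.span k (Set.range fun p : Fin n × Fin n ↦ c p.1 p.2) := by
  obtain ⟨V, hV, ho, hΔ⟩ := exists_finiteDimensional_subcomodule (k := k) o
  let v := Module.finBasis k V
  have hex (j) : ∃ c : Fin (Module.finrank k V) → O,
      comul (R := k) (v j : O) = ∑ i, (v i : O) ⊗ₜ c i := by
    obtain ⟨w, hw⟩ := hΔ _ (v j).2
    obtain ⟨c, rfl⟩ := TensorProduct.eq_repr_basis_left v w
    refine ⟨c, ?_⟩
    rw [← hw, Finsupp.sum_fintype _ _ (by simp), map_sum]
    simp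
  choose c hc using hex
  choose φ hφ using fun i ↦ (v.coord i).exists_extend
  have hφv (i j) : φ i (v j) = if i = j then 1 else 0 := by
    have := congr($(hφ i) (v j))
    rw [LinearMap.comp_apply, Submodule.subtype_apply] at this
    rw [this, v.coord_apply, v.repr_self, Finsupp.single_apply]
    simp only [eq_comm]
  have hsum {Y : Type} [AddCommGroup Y] [Module k Y] (m) (y : Fin (Module.finrank k V) → Y) :
      TensorProduct.lid k Y ((φ m).rTensor Y (∑ i, (v i : O) ⊗ₜ y i)) = y m := by
    simp [hφv]
  refine ⟨_, fun i j ↦ c j i, fun m j ↦ ?_, fun m j ↦ ?_, ?_⟩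
  · have h := coassoc_apply (R := k) (v j : O)
    rw [hc j, map_sum, map_sum, map_sum] at h
    simp only [LinearMap.rTensor_tmul, LinearMap.lTensor_tmul, hc, sum_tmul, map_sum,
      TensorProduct.assoc_tmul] at h
    rw [Finset.sum_comm] at h
    simp only [← tmul_sum] at h
    have h' := congrArg (fun t ↦ TensorProduct.lid k _ ((φ m).rTensor _ t)) h
    simp only [hsum] at h'
    exact h'.symm
  · have h := lTensor_counit_comul (R := k) (v j : O)
    rw [hc j, map_sum] at h
    simp only [LinearMap.lTensor_tmul] at h
    have h' := congrArg (fun t ↦ TensorProduct.lid k _ ((φ m).rTensor _ t)) h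
    simp only [hsum] at h'
    simpa [hφv] using h'
  · have hmem (j) : (v j : O) ∈ Submodule.span k
        (Set.range fun p : Fin (Module.finrank k V) × Fin (Module.finrank k V) ↦ c p.2 p.1) := by
      have h := congrArg (TensorProduct.lid k O) (rTensor_counit_comul (R := k) (v j : O))
      rw [hc j, map_sum, map_sum, TensorProduct.lid_tmul, one_smul] at h
      rw [← h]
      refine sum_mem fun i _ ↦ ?_
      rw [LinearMap.rTensor_tmul, TensorProduct.lid_tmul]
      exact Submodule.smul_mem _ _ (Submodule.subset_span ⟨(i, j), rfl⟩)
    have h := congrArg V.subtype (v.sum_repr ⟨o, ho⟩)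
    rw [map_sum] at h
    change _ = o at h
    rw [← h]
    exact sum_mem fun j _ ↦ Submodule.smul_mem _ _ (hmem j)

end MatrixCoefficients

section InducedHopfAlgebra

open Coalgebra HopfAlgebra

variable {k O B : Type} [Field k] [CommRing O] [HopfAlgebra k O] [CommRing B] [Algebra k B]
  (f : B →ₐ[k] O) (hf : Function.Injective f) (Δ : B →ₐ[k] B ⊗[k] B)
  (hΔ : ∀ b, TensorProduct.map f.toLinearMap f.toLinearMap (Δ b) = comul (R := k) (f b))
  (S : B →ₗ[k] B) (hS : ∀ b, f (S b) = antipode k (f b))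
include hf hΔ

theorem coassoc_of_injective (b : B) :
    TensorProduct.assoc k B B B (Δ.toLinearMap.rTensor B (Δ b)) =
      Δ.toLinearMap.lTensor B (Δ b) := by
  have hinj : Function.Injective (TensorProduct.map f.toLinearMap
      (TensorProduct.map f.toLinearMap f.toLinearMap)) :=
    TensorProduct.map_injective_of_flat_flat _ _ hf
      (TensorProduct.map_injective_of_flat_flat _ _ hf hf)
  apply hinj
  have hassoc (w : B ⊗[k] B) (y : B) : TensorProduct.map f.toLinearMap
      (TensorProduct.map f.toLinearMap f.toLinearMap) (TensorProduct.assoc k B B B (w ⊗ₜ y)) =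
      TensorProduct.assoc k O O O
        (TensorProduct.map f.toLinearMap f.toLinearMap w ⊗ₜ f y) := by
    induction w with
    | zero => simp only [zero_tmul, map_zero]
    | add s t hs ht => simp only [add_tmul, map_add, hs, ht]
    | tmul a b => rfl
  have h₁ (t : B ⊗[k] B) : TensorProduct.map f.toLinearMap
      (TensorProduct.map f.toLinearMap f.toLinearMap)
        (TensorProduct.assoc k B B B (Δ.toLinearMap.rTensor B t)) =
      TensorProduct.assoc k O O O ((comul (R := k) (A := O)).rTensor O
        (TensorProduct.map f.toLinearMap f.toLinearMap t)) := by
    induction t with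
    | zero => simp only [map_zero]
    | add s t hs ht => simp only [map_add, hs, ht]
    | tmul x y =>
      refine (hassoc (Δ x) y).trans ?_
      rw [hΔ]
      rfl
  have h₂ (t : B ⊗[k] B) : TensorProduct.map f.toLinearMap
      (TensorProduct.map f.toLinearMap f.toLinearMap) (Δ.toLinearMap.lTensor B t) =
      (comul (R := k) (A := O)).lTensor O
        (TensorProduct.map f.toLinearMap f.toLinearMap t) := by
    induction t with
    | zero => simp only [map_zero]
    | add s t hs ht => simp only [map_add, hs, ht]
    | tmul x y => exact congrArg (f x ⊗ₜ[k] ·) (hΔ y)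
  rw [h₁, h₂, hΔ, coassoc_apply]

theorem rTensor_counit_of_injective (b : B) :
    (counit (R := k) (A := O) ∘ₗ f.toLinearMap).rTensor B (Δ b) = 1 ⊗ₜ b := by
  have hinj : Function.Injective (f.toLinearMap.lTensor k) :=
    Module.Flat.lTensor_preserves_injective_linearMap _ hf
  apply hinj
  have h₁ (t : B ⊗[k] B) : f.toLinearMap.lTensor k
      ((counit (R := k) (A := O) ∘ₗ f.toLinearMap).rTensor B t) =
      (counit (R := k) (A := O)).rTensor O
        (TensorProduct.map f.toLinearMap f.toLinearMap t) := by
    induction t with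
    | zero => simp only [map_zero]
    | add s t hs ht => simp only [map_add, hs, ht]
    | tmul x y => rfl
  rw [h₁, hΔ, rTensor_counit_comul]
  rfl

theorem lTensor_counit_of_injective (b : B) :
    (counit (R := k) (A := O) ∘ₗ f.toLinearMap).lTensor B (Δ b) = b ⊗ₜ 1 := by
  have hinj : Function.Injective (f.toLinearMap.rTensor k) :=
    Module.Flat.rTensor_preserves_injective_linearMap _ hf
  apply hinj
  have h₁ (t : B ⊗[k] B) : f.toLinearMap.rTensor k
      ((counit (R := k) (A := O) ∘ₗ f.toLinearMap).lTensor B t) =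
      (counit (R := k) (A := O)).lTensor O
        (TensorProduct.map f.toLinearMap f.toLinearMap t) := by
    induction t with
    | zero => simp only [map_zero]
    | add s t hs ht => simp only [map_add, hs, ht]
    | tmul x y => rfl
  rw [h₁, hΔ, lTensor_counit_comul]
  rfl

/-- A Hopf algebra structure induced along an injective algebra homomorphism. -/
noncomputable abbrev HopfAlgebra.ofInjective : HopfAlgebra k B :=
  let C : Coalgebra k B :=
    { comul := Δ.toLinearMap
      counit := counit (R := k) (A := O) ∘ₗ f.toLinearMap
      coassoc := LinearMap.ext (coassoc_of_injective f hf Δ hΔ)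
      rTensor_counit_comp_comul := LinearMap.ext (rTensor_counit_of_injective f hf Δ hΔ)
      lTensor_counit_comp_comul := LinearMap.ext (lTensor_counit_of_injective f hf Δ hΔ) }
  { Bialgebra.mk' k B (by change counit (R := k) (f 1) = 1; simp)
      (fun {a b} ↦ by change counit (R := k) (f (a * b)) = counit (f a) * counit (f b); simp)
      (map_one Δ) (fun {a b} ↦ map_mul Δ a b) with
    antipode := S
    mul_antipode_rTensor_comul := by
      ext b
      have h (t : B ⊗[k] B) : f (LinearMap.mul' k B (S.rTensor B t)) =
          LinearMap.mul' k O ((antipode k).rTensor O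
            (TensorProduct.map f.toLinearMap f.toLinearMap t)) := by
        induction t with
        | zero => simp only [map_zero]
        | add s t hs ht => simp only [map_add, hs, ht]
        | tmul x y => simp [hS]
      apply hf
      refine (h (Δ b)).trans ?_
      rw [hΔ, mul_antipode_rTensor_comul_apply]
      exact (f.commutes _).symm
    mul_antipode_lTensor_comul := by
      ext b
      have h (t : B ⊗[k] B) : f (LinearMap.mul' k B (S.lTensor B t)) =
          LinearMap.mul' k O ((antipode k).lTensor O
            (TensorProduct.map f.toLinearMap f.toLinearMap t)) := by
        induction t with
        | zero => simp only [map_zero]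
        | add s t hs ht => simp only [map_add, hs, ht]
        | tmul x y => simp [hS]
      apply hf
      refine (h (Δ b)).trans ?_
      rw [hΔ, mul_antipode_lTensor_comul_apply]
      exact (f.commutes _).symm }

end InducedHopfAlgebra

section FiniteTypeHopfSubalgebra

open Coalgebra HopfAlgebra

variable {k O : Type} [Field k] [CommRing O] [HopfAlgebra k O]

section

variable {n : ℕ} {c : Matrix (Fin n) (Fin n) O}
  (hΔ : ∀ i j, comul (R := k) (c i j) = ∑ l, c i l ⊗ₜ c l j)
  (hε : ∀ i j, counit (R := k) (c i j) = if i = j then 1 else 0)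
include hΔ hε

theorem map_antipode_mul_self : c.map (antipodeAlgHom k O) * c = 1 := by
  ext i j
  have h := mul_antipode_rTensor_comul_apply (R := k) (c i j)
  rw [hΔ, hε, map_sum, map_sum] at h
  rw [Matrix.mul_apply, Matrix.one_apply]
  refine h.trans ?_
  split_ifs <;> simp

theorem antipode_antipode_matrix_coefficient (i j : Fin n) :
    antipode k (antipode k (c i j)) = c i j := by
  have h := map_antipode_mul_self hΔ hε
  have h' := congrArg (fun M ↦ M.map (antipodeAlgHom k O)) h
  simp only [Matrix.map_mul] at h'
  rw [Matrix.map_one _ (map_zero _) (map_one _)] at h'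
  have key := left_inv_eq_right_inv h' h
  exact congrFun (congrFun key i) j

theorem comul_antipode_matrix_coefficient (i j : Fin n) :
    comul (R := k) (antipode k (c i j)) = ∑ l, antipode k (c l j) ⊗ₜ antipode k (c i l) := by
  let a : O →ₐ[k] O ⊗[k] O := Algebra.TensorProduct.includeLeft
  let b : O →ₐ[k] O ⊗[k] O := Algebra.TensorProduct.includeRight
  let d : Matrix (Fin n) (Fin n) O := c.map (antipodeAlgHom k O)
  have hd : d * c = 1 := map_antipode_mul_self hΔ hε
  have hmap (φ : O →ₐ[k] O ⊗[k] O) : d.map φ * c.map φ = 1 := by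
    rw [← Matrix.map_mul, hd, Matrix.map_one _ (map_zero _) (map_one _)]
  have hc : c.map (Bialgebra.comulAlgHom k O) = c.map a * c.map b := by
    ext i j
    rw [Matrix.mul_apply]
    refine (hΔ i j).trans (Finset.sum_congr rfl fun l _ ↦ ?_)
    simp [a, b]
  have h : d.map b * d.map a * c.map (Bialgebra.comulAlgHom k O) = 1 := by
    rw [hc, mul_assoc, ← mul_assoc (d.map a), hmap, one_mul, hmap]
  have key := left_inv_eq_right_inv (hmap (Bialgebra.comulAlgHom k O)) (mul_eq_one_comm.1 h)
  have := congrFun (congrFun key i) j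
  rw [Matrix.mul_apply] at this
  refine this.trans (Finset.sum_congr rfl fun l _ ↦ ?_)
  simp [a, b, d]

end

/-- Finitely many elements of a commutative Hopf algebra lie in a Hopf subalgebra of
finite type. -/
theorem exists_finiteType_hopfSubalgebra (F : Set O) (hF : F.Finite) :
    ∃ (B : Type) (_ : CommRing B) (_ : HopfAlgebra k B) (j : B →ₐc[k] O),
      Function.Injective j ∧ Algebra.FiniteType k B ∧ F ⊆ Set.range j := by
  choose n c hΔ hε hmem using exists_matrix_coefficients (k := k) (O := O)
  let G : Set O := ⋃ o ∈ F, Set.range (fun p : Fin (n o) × Fin (n o) ↦ c o p.1 p.2)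
  let G' : Set O := G ∪ antipodeAlgHom k O '' G
  have hG : G.Finite := hF.biUnion fun o _ ↦ Set.finite_range _
  let B := Algebra.adjoin k G'
  let T : B ⊗[k] B →ₐ[k] O ⊗[k] O := Algebra.TensorProduct.map B.val B.val
  have hT : Function.Injective T :=
    TensorProduct.map_injective_of_flat_flat B.val.toLinearMap B.val.toLinearMap
      Subtype.val_injective Subtype.val_injective
  have hcB {o} (ho : o ∈ F) (i j) : c o i j ∈ G := Set.mem_biUnion ho ⟨(i, j), rfl⟩
  have h₁ {x} (hx : x ∈ G) : x ∈ B := Algebra.subset_adjoin (Or.inl hx)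
  have h₂ {x} (hx : x ∈ G) : antipode k x ∈ B := Algebra.subset_adjoin (Or.inr ⟨x, hx, rfl⟩)
  have htmul {x y} (hx : x ∈ B) (hy : y ∈ B) : x ⊗ₜ y ∈ T.range := ⟨⟨x, hx⟩ ⊗ₜ ⟨y, hy⟩, rfl⟩
  have hBΔ : B ≤ T.range.comap (Bialgebra.comulAlgHom k O) := by
    refine Algebra.adjoin_le ?_
    rintro _ (h | ⟨_, h, rfl⟩) <;> obtain ⟨o, ho, ⟨i, j⟩, rfl⟩ := Set.mem_iUnion₂.1 h
    · change comul (c o i j) ∈ T.range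
      rw [hΔ]
      exact sum_mem fun l _ ↦ htmul (h₁ (hcB ho _ _)) (h₁ (hcB ho _ _))
    · change comul (antipode k (c o i j)) ∈ T.range
      rw [comul_antipode_matrix_coefficient (hΔ o) (hε o)]
      exact sum_mem fun l _ ↦ htmul (h₂ (hcB ho _ _)) (h₂ (hcB ho _ _))
  have hBS : B ≤ B.comap (antipodeAlgHom k O) := by
    refine Algebra.adjoin_le ?_
    rintro _ (h | ⟨_, h, rfl⟩)
    · exact h₂ h
    · obtain ⟨o, ho, ⟨i, j⟩, rfl⟩ := Set.mem_iUnion₂.1 h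
      change antipode k (antipode k (c o i j)) ∈ B
      rw [antipode_antipode_matrix_coefficient (hΔ o) (hε o)]
      exact h₁ h
  let Δ : B →ₐ[k] B ⊗[k] B := (AlgEquiv.ofInjective T hT).symm.toAlgHom.comp
    (((Bialgebra.comulAlgHom k O).comp B.val).codRestrict _ fun b ↦ hBΔ b.2)
  have hΔ' (b : B) : TensorProduct.map B.val.toLinearMap B.val.toLinearMap (Δ b) =
      comul (R := k) (B.val b) :=
    congrArg Subtype.val ((AlgEquiv.ofInjective T hT).apply_symm_apply _)
  let H : HopfAlgebra k B := HopfAlgebra.ofInjective B.val Subtype.val_injective Δ hΔ'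
    ((((antipodeAlgHom k O).comp B.val).codRestrict B fun b ↦ hBS b.2).toLinearMap)
    (fun b ↦ rfl)
  refine ⟨B, inferInstance, H, .ofAlgHom B.val rfl (AlgHom.ext hΔ'), Subtype.val_injective,
    ?_, fun o ho ↦ ?_⟩
  · exact (Subalgebra.fg_iff_finiteType B).1
      (Subalgebra.fg_def.2 ⟨G', hG.union (hG.image _), rfl⟩)
  · have hle : Submodule.span k (Set.range fun p : Fin (n o) × Fin (n o) ↦ c o p.1 p.2) ≤
        Subalgebra.toSubmodule B := by
      rw [Submodule.span_le]
      rintro _ ⟨p, rfl⟩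
      exact h₁ (hcB ho _ _)
    exact ⟨⟨o, hle (hmem o)⟩, rfl⟩

end FiniteTypeHopfSubalgebra

namespace HopfModule

variable {k O A : Type} [Field k] [CharZero k] [CommRing O] [HopfAlgebra k O] [Ring A]
  [HopfAlgebra k A] [Module O A]

theorem flat_of_injective {ι : O →ₐc[k] A} (hsmul : ∀ (o : O) (a : A), o • a = ι o * a)
    (hι : Function.Injective ι) : Module.Flat O A := by
  rw [Module.Flat.iff_forall_isTrivialRelation]
  intro l f x hfx
  obtain ⟨B, _, _, j, hj, hB, hF⟩ :=
    exists_finiteType_hopfSubalgebra (k := k) (Set.range f) (Set.finite_range f)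
  choose g hg using fun i ↦ hF ⟨i, rfl⟩
  have : IsNoetherianRing B := Algebra.FiniteType.isNoetherianRing k B
  let := Module.compHom A (j : B →ₐ[k] O).toRingHom
  have hsmul' (b : B) (a : A) : b • a = (ι.comp j) b * a := hsmul _ _
  have : IsScalarTower k B A := ⟨fun r b a ↦ by simp [hsmul']⟩
  have hflat : Module.Flat B A := flat_of_isNoetherianRing hsmul' (hι.comp hj)
  rw [Module.Flat.iff_forall_isTrivialRelation] at hflat
  obtain ⟨m, a, y, hx, ha⟩ := hflat (f := g) (x := x)
    (by rw [← hfx]; exact Finset.sum_congr rfl fun i _ ↦ by rw [← hg]; rfl)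
  refine ⟨m, fun i l ↦ j (a i l), y, hx, fun l ↦ ?_⟩
  have := congrArg j (ha l)
  simpa [hg] using this

end HopfModule

/-- Let `ι : O → A` be an injective homomorphism of Hopf algebras over `ℂ`,
with `O` commutative.  Regard `A` as a left `O`-module via `ι` followed by left multiplication
in `A`.  Then `A` is faithfully flat over `O`: it is a flat `O`-module, and for every
`O`-module `M`, if `M ⊗[O] A = 0` then `M = 0`. -/
theorem statement0 (O A : Type) [CommRing O] [Ring A]
    [HopfAlgebra ℂ O] [HopfAlgebra ℂ A]
    (ι : O →ₐc[ℂ] A) (hι : Function.Injective ι) :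
    letI : Module O A := Module.compHom A (ι : O →ₐ[ℂ] A).toRingHom
    Module.Flat O A ∧
      ∀ (M : Type) [AddCommGroup M] [Module O M],
        Subsingleton (M ⊗[O] A) → Subsingleton M := by
  let : Module O A := Module.compHom A (ι : O →ₐ[ℂ] A).toRingHom
  have hsmul (o : O) (a : A) : o • a = ι o * a := rfl
  have : IsScalarTower ℂ O A := ⟨fun r o a ↦ by simp [hsmul]⟩
  have : Module.Flat O A := HopfModule.flat_of_injective hsmul hι
  exact ⟨this, fun M _ _ _ ↦ HopfModule.subsingleton_of_flat hsmul hι M⟩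
end

section
/- Assume O is commutative. For every ℂ-algebra homomorphism γ : O → ℂ, the fiber ℂ_γ ⊗_O A is nonzero, where ℂ_γ denotes ℂ with the O-module structure given by γ; equivalently, the left ideal ι(ker γ)·A of A is proper. -/
open TensorProduct

section MinimalPrime

variable {R : Type*} [CommRing R]

/-- An element of a minimal prime `p` becomes nilpotent after localizing at `p`. -/
lemma exists_notMem_mul_pow_eq_zero {p : Ideal R} (hp : p ∈ minimalPrimes R) {x : R}
    (hx : x ∈ p) : ∃ t ∉ p, ∃ n : ℕ, t * x ^ n = 0 := by
  have : p.IsPrime := hp.1.1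
  have h := IsLocalization.AtPrime.radical_map_of_mem_minimalPrimes
    (A := Localization.AtPrime p) p ⊥ hp
  have hx' : algebraMap R (Localization.AtPrime p) x ∈
      (Ideal.map (algebraMap R (Localization.AtPrime p)) ⊥).radical :=
    h ▸ Ideal.mem_map_of_mem _ hx
  obtain ⟨n, hn⟩ := hx'
  rw [Ideal.map_bot, Ideal.mem_bot, ← map_pow,
    IsLocalization.map_eq_zero_iff p.primeCompl] at hn
  obtain ⟨t, ht⟩ := hn
  exact ⟨t, t.2, n, ht⟩

/-- The kernel of the localization map `R → Rₚ`. -/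
def primeTorsionIdeal (p : Ideal R) [p.IsPrime] : Ideal R :=
  RingHom.ker (algebraMap R (Localization.AtPrime p))

lemma mem_primeTorsionIdeal {p : Ideal R} [p.IsPrime] {x : R} :
    x ∈ primeTorsionIdeal p ↔ ∃ t ∉ p, t * x = 0 := by
  rw [primeTorsionIdeal, RingHom.mem_ker, IsLocalization.map_eq_zero_iff p.primeCompl]
  exact ⟨fun ⟨t, ht⟩ ↦ ⟨t, t.2, ht⟩, fun ⟨t, h, ht⟩ ↦ ⟨⟨t, h⟩, ht⟩⟩

lemma le_radical_primeTorsionIdeal {p : Ideal R} [p.IsPrime] (hp : p ∈ minimalPrimes R) :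
    p ≤ (primeTorsionIdeal p).radical := fun x hx ↦ by
  obtain ⟨t, ht, n, h⟩ := exists_notMem_mul_pow_eq_zero hp hx
  exact ⟨n, mem_primeTorsionIdeal.2 ⟨t, ht, h⟩⟩

lemma exists_notMem_smul_eq_zero {M : Type*} [AddCommGroup M] [Module R M] {p : Ideal R}
    [p.IsPrime] {m : M} (hm : m ∈ primeTorsionIdeal p • (⊤ : Submodule R M)) :
    ∃ t ∉ p, t • m = 0 := by
  induction hm using Submodule.smul_induction_on' with
  | smul r hr n hn =>
    obtain ⟨t, ht, h⟩ := mem_primeTorsionIdeal.1 hr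
    exact ⟨t, ht, by rw [smul_smul, h, zero_smul]⟩
  | add x hx y hy ihx ihy =>
    obtain ⟨s, hs, hsx⟩ := ihx
    obtain ⟨t, ht, hty⟩ := ihy
    refine ⟨s * t, fun h ↦ (Ideal.IsPrime.mem_or_mem ‹_› h).elim hs ht, ?_⟩
    rw [smul_add, mul_smul s t y, hty, mul_comm, mul_smul, hsx, smul_zero, smul_zero, add_zero]

lemma exists_fg_le_mem_smul_top {M : Type*} [AddCommGroup M] [Module R M] {I : Ideal R} {m : M}
    (hm : m ∈ I • (⊤ : Submodule R M)) :
    ∃ J : Ideal R, J.FG ∧ J ≤ I ∧ m ∈ J • (⊤ : Submodule R M) := by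
  induction hm using Submodule.smul_induction_on' with
  | smul r hr n hn =>
    exact ⟨Ideal.span {r}, Submodule.fg_span_singleton r, by simpa [Ideal.span_le] using hr,
      Submodule.smul_mem_smul (Ideal.mem_span_singleton_self r) trivial⟩
  | add x hx y hy ihx ihy =>
    obtain ⟨J, hJ, hJI, hxJ⟩ := ihx
    obtain ⟨K, hK, hKI, hyK⟩ := ihy
    exact ⟨J ⊔ K, Submodule.FG.sup hJ hK, sup_le hJI hKI,
      add_mem (Submodule.smul_mono_left le_sup_left hxJ)
        (Submodule.smul_mono_left le_sup_right hyK)⟩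

variable {A : Type*} [Ring A] [Module R A] [IsScalarTower R A A]

lemma smul_mem_smul_top_of_smul_one_mem {J : Ideal R} {s : R}
    (hs : s • (1 : A) ∈ J • (⊤ : Submodule R A)) (x : A) : s • x ∈ J • (⊤ : Submodule R A) := by
  let f : A →ₗ[R] A :=
    { toFun := fun y ↦ y * x
      map_add' := fun y z ↦ add_mul y z x
      map_smul' := fun r y ↦ smul_mul_assoc r y x }
  have h : f (s • 1) ∈ (J • (⊤ : Submodule R A)).map f := Submodule.mem_map_of_mem hs
  rw [Submodule.map_smul''] at h
  simpa [f] using Submodule.smul_mono le_rfl le_top h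

lemma pow_smul_mem_pow_smul_top {J : Ideal R} {s : R}
    (hs : s • (1 : A) ∈ J • (⊤ : Submodule R A)) (n : ℕ) (x : A) :
    s ^ n • x ∈ J ^ n • (⊤ : Submodule R A) := by
  induction n generalizing x with
  | zero => simp
  | succ n ih =>
    suffices h : ∀ y ∈ J • (⊤ : Submodule R A), s ^ n • y ∈ J • J ^ n • (⊤ : Submodule R A) by
      rw [pow_succ s, pow_succ' J, mul_smul, mul_smul]
      exact h _ (smul_mem_smul_top_of_smul_one_mem hs x)
    intro y hy
    induction hy using Submodule.smul_induction_on' with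
    | smul r hr z _ =>
      rw [smul_comm (s ^ n) r z]
      exact Submodule.smul_mem_smul hr (ih z)
    | add y _ z _ hy hz =>
      rw [smul_add]
      exact add_mem hy hz

/-- If `R` acts faithfully on the unit of `A`, then `1` does not vanish in the fiber of `A` at
the generic point of an irreducible component of `Spec R`. -/
lemma smul_one_notMem_smul_top (hA : ∀ r : R, r • (1 : A) = 0 → r = 0) {p : Ideal R}
    (hp : p ∈ minimalPrimes R) {s : R} (hs : s ∉ p) :
    s • (1 : A) ∉ p • (⊤ : Submodule R A) := fun h ↦ by
  have : p.IsPrime := hp.1.1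
  obtain ⟨J, hJ, hJp, hsJ⟩ := exists_fg_le_mem_smul_top h
  obtain ⟨n, hn⟩ := Ideal.exists_pow_le_of_le_radical_of_fg
    (hJp.trans (le_radical_primeTorsionIdeal hp)) hJ
  obtain ⟨t, ht, h0⟩ := exists_notMem_smul_eq_zero
    (Submodule.smul_mono_left hn (pow_smul_mem_pow_smul_top hsJ n (1 : A)))
  rw [smul_smul] at h0
  have hmem : t * s ^ n ∈ p := hA _ h0 ▸ p.zero_mem
  exact (Ideal.IsPrime.mem_or_mem this hmem).elim ht
    fun h ↦ hs (Ideal.IsPrime.mem_of_pow_mem this n h)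

/-- An element of a module which is nonzero in the fiber at `p` is detected by a functional with
values in the residue field. -/
lemma exists_linearMap_residueField_eq_one {M : Type*} [AddCommGroup M] [Module R M] {p : Ideal R}
    [p.IsPrime] {m : M} (hm : ∀ s ∉ p, s • m ∉ p • (⊤ : Submodule R M)) :
    ∃ f : M →ₗ[R] p.ResidueField, f m = 1 := by
  let B := M ⧸ p • (⊤ : Submodule R M)
  let b : B := Submodule.Quotient.mk m
  have hb : (1 : p.ResidueField) ⊗ₜ[R ⧸ p] b ≠ 0 := fun h ↦ by
    obtain ⟨s, hs⟩ := (IsLocalizedModule.eq_zero_iff (nonZeroDivisors (R ⧸ p))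
      (TensorProduct.mk (R ⧸ p) p.ResidueField B 1)).1 h
    obtain ⟨r, hr⟩ := Ideal.Quotient.mk_surjective s.1
    refine hm r (fun hrp ↦ nonZeroDivisors.ne_zero s.2 ?_) ?_
    · rw [← hr, Ideal.Quotient.eq_zero_iff_mem.2 hrp]
    · rw [← Submodule.Quotient.mk_eq_zero]
      have : (Ideal.Quotient.mk p r) • b = 0 := by rw [hr]; exact hs
      exact this
  obtain ⟨g, hg⟩ := Module.Projective.exists_dual_eq_one p.ResidueField hb
  refine ⟨{ toFun := fun x ↦ g (1 ⊗ₜ (Submodule.Quotient.mk x : B))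
            map_add' := fun x y ↦ ?_
            map_smul' := fun r x ↦ ?_ }, hg⟩
  · rw [Submodule.Quotient.mk_add, TensorProduct.tmul_add, map_add]
  · have : (Submodule.Quotient.mk (r • x) : B) =
        (Ideal.Quotient.mk p r) • (Submodule.Quotient.mk x : B) := rfl
    rw [this, TensorProduct.tmul_smul, RingHom.id_apply]
    have h2 : (Ideal.Quotient.mk p r) • ((1 : p.ResidueField) ⊗ₜ[R ⧸ p]
        (Submodule.Quotient.mk x : B)) = (algebraMap R p.ResidueField r) • (1 ⊗ₜ
        (Submodule.Quotient.mk x : B)) := by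
      rw [TensorProduct.smul_tmul', TensorProduct.smul_tmul', Algebra.smul_def, smul_eq_mul]
      rfl
    rw [h2, map_smul, smul_eq_mul, Algebra.smul_def]

end MinimalPrime

section Semiinvariant

variable {k : Type*} [Field k]

/-- For an injective algebra map `ι : R → A` with `R` commutative and `p` a minimal prime of `R`,
there is a normalized functional on `A` with values in the residue field of `p` that is semilinear
with respect to left multiplication by `R`. -/
lemma exists_semiinvariant_of_mem_minimalPrimes {R A : Type*} [CommRing R] [Ring A] [Algebra k R]
    [Algebra k A] (ι : R →ₐ[k] A) (hι : Function.Injective ι) {p : Ideal R} [p.IsPrime]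
    (hp : p ∈ minimalPrimes R) :
    ∃ f : A →ₗ[k] p.ResidueField, f 1 = 1 ∧
      ∀ r x, f (ι r * x) = algebraMap R p.ResidueField r * f x := by
  let _ : Module R A := Module.compHom A ι.toRingHom
  have smul_eq (r : R) (x : A) : r • x = ι r * x := rfl
  have : IsScalarTower R A A := ⟨fun r x y ↦ mul_assoc (ι r) x y⟩
  have : IsScalarTower k R A := ⟨fun c r x ↦ by
    rw [smul_eq, smul_eq, map_smul, smul_mul_assoc]⟩
  obtain ⟨f, hf⟩ := exists_linearMap_residueField_eq_one (p := p) (m := (1 : A)) fun s hs ↦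
    smul_one_notMem_smul_top (fun r hr ↦ hι (by simpa [smul_eq] using hr)) hp hs
  exact ⟨f.restrictScalars k, hf, fun r x ↦ by
    rw [← Algebra.smul_def]; exact f.map_smul r x⟩

open Coalgebra WithConv

/-- Semiinvariant functionals multiply under convolution. -/
lemma convMul_semiinvariant {O A K : Type*} [CommRing O] [Ring A] [CommRing K] [Bialgebra k O]
    [Bialgebra k A] [Algebra k K] (ι : O →ₐc[k] A) {χ ψ : O →ₐ[k] K} {f g : A →ₗ[k] K}
    (hf : ∀ o x, f (ι o * x) = χ o * f x) (hg : ∀ o x, g (ι o * x) = ψ o * g x) (o : O) (x : A) :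
    (toConv f * toConv g) (ι o * x) = (toConv χ * toConv ψ) o * (toConv f * toConv g) x := by
  have hι : comul (R := k) (ι o) = TensorProduct.map (ι : O →ₗ[k] A) (ι : O →ₗ[k] A) (comul o) :=
    (CoalgHomClass.map_comp_comul_apply ι o).symm
  rw [AlgHom.convMul_apply, LinearMap.convMul_apply, LinearMap.convMul_apply, Bialgebra.comul_mul,
    hι]
  generalize comul (R := k) o = a
  generalize comul (R := k) x = b
  induction a with
  | zero => simp
  | add a a' h h' => simp only [map_add, add_mul, h, h']
  | tmul a a' =>
    induction b with
    | zero => simp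
    | add b b' h h' => simp only [map_add, mul_add, h, h']
    | tmul b b' =>
      simp [hf, hg]
      ring

/-- The map `o ↦ S(o₁) γ(o₂)`, i.e. the translated inversion `g ↦ g⁻¹ γ` on points, is an
automorphism of the algebra `O`. -/
lemma exists_algEquiv_convMul_eq {O : Type*} [CommRing O] [HopfAlgebra k O] (γ : O →ₐ[k] k) :
    ∃ e : O ≃ₐ[k] O,
      toConv (AlgHom.id k O) * toConv (e : O →ₐ[k] O) = toConv ((Algebra.ofId k O).comp γ) := by
  let u : WithConv (O →ₐ[k] O) := toConv (AlgHom.id k O)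
  let c : WithConv (O →ₐ[k] O) := toConv ((Algebra.ofId k O).comp γ)
  have comp_c (φ : O →ₐ[k] O) : toConv (φ.comp c.ofConv) = c :=
    congrArg toConv (AlgHom.ext fun o ↦ φ.commutes (γ o))
  have comp_inv (φ : O →ₐ[k] O) : toConv (φ.comp u⁻¹.ofConv) = (toConv φ)⁻¹ := rfl
  have comp_mul (φ : O →ₐ[k] O) (a b : WithConv (O →ₐ[k] O)) :
      toConv (φ.comp (a * b).ofConv) = toConv (φ.comp a.ofConv) * toConv (φ.comp b.ofConv) :=
    congrArg toConv (AlgHom.comp_convMul_distrib φ a b)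
  have h₁ : toConv ((u⁻¹ * c).ofConv.comp (c * u⁻¹).ofConv) = u := by
    rw [comp_mul, comp_c, comp_inv, toConv_ofConv]; group
  have h₂ : toConv ((c * u⁻¹).ofConv.comp (u⁻¹ * c).ofConv) = u := by
    rw [comp_mul, comp_c, comp_inv, toConv_ofConv]; group
  refine ⟨AlgEquiv.ofAlgHom (u⁻¹ * c).ofConv (c * u⁻¹).ofConv
    (toConv_injective h₁) (toConv_injective h₂), ?_⟩
  exact mul_inv_cancel_left u c

/-- Every character of a commutative Hopf subalgebra admits a normalized semiinvariant functional,
after extending scalars to some field. -/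
lemma exists_semiinvariant {O : Type*} {A : Type*} [CommRing O] [Ring A] [HopfAlgebra k O]
    [HopfAlgebra k A] (ι : O →ₐc[k] A) (hι : Function.Injective ι) (γ : O →ₐ[k] k) :
    ∃ (p : Ideal O) (_ : p.IsPrime) (f : A →ₗ[k] p.ResidueField), f 1 = 1 ∧
      ∀ o x, f (ι o * x) = algebraMap k p.ResidueField (γ o) * f x := by
  have : Nontrivial O := RingHom.domain_nontrivial γ.toRingHom
  obtain ⟨q, hq⟩ := Ideal.exists_maximal O
  obtain ⟨p, hp, -⟩ := Ideal.exists_minimalPrimes_le (I := (⊥ : Ideal O)) (J := q) bot_le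
  have hp' : p.IsPrime := hp.1.1
  obtain ⟨e, he⟩ := exists_algEquiv_convMul_eq γ
  let η : O →ₐ[k] p.ResidueField := IsScalarTower.toAlgHom k O p.ResidueField
  obtain ⟨f, hf, hf'⟩ := exists_semiinvariant_of_mem_minimalPrimes (ι : O →ₐ[k] A) hι hp
  obtain ⟨g, hg, hg'⟩ := exists_semiinvariant_of_mem_minimalPrimes
    ((ι : O →ₐ[k] A).comp (e.symm : O →ₐ[k] O)) (hι.comp e.symm.injective) hp
  have hχ : toConv η * toConv (η.comp (e : O →ₐ[k] O)) =
      toConv ((Algebra.ofId k p.ResidueField).comp γ) := by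
    have h := AlgHom.comp_convMul_distrib η (toConv (AlgHom.id k O)) (toConv (e : O →ₐ[k] O))
    rw [he] at h
    refine (congrArg toConv h).symm.trans (congrArg toConv (AlgHom.ext fun o ↦ ?_))
    exact η.commutes (γ o)
  refine ⟨p, hp', (toConv f * toConv g).ofConv, ?_, fun o x ↦ ?_⟩
  · change (toConv f * toConv g) 1 = 1
    simp [LinearMap.convMul_apply, Algebra.TensorProduct.one_def, hf, hg]
  · have h := convMul_semiinvariant ι (χ := η) (ψ := η.comp (e : O →ₐ[k] O)) (f := f) (g := g)
      hf' (fun o x ↦ by simpa [η] using hg' (e o) x) o x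
    rw [hχ] at h
    exact h

end Semiinvariant

/-- A nonzero `S`-valued linear map on `M` yields a nonzero base change. -/
lemma TensorProduct.nontrivial_of_linearMap {R S M : Type*} [CommRing R] [CommRing S]
    [AddCommGroup M] [Module R S] [IsScalarTower R S S] [Module R M] (f : M →ₗ[R] S) {m : M}
    (hm : f m ≠ 0) : Nontrivial (S ⊗[R] M) := by
  have : SMulCommClass R S S := ⟨fun r x y ↦ by
    rw [smul_eq_mul, smul_eq_mul, mul_comm x, ← smul_mul_assoc, mul_comm]⟩
  let g : S ⊗[R] M →ₗ[R] S := TensorProduct.lift ((LinearMap.mul R S).compl₂ f)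
  refine ⟨⟨1 ⊗ₜ m, 0, fun h ↦ hm ?_⟩⟩
  simpa [g] using congrArg g h

/-- Let `ι : O → A` be an injective homomorphism of Hopf algebras over `ℂ`,
with `O` commutative.  For every `ℂ`-algebra homomorphism `γ : O → ℂ`, the fiber
`ℂ_γ ⊗[O] A` is nonzero (where `ℂ_γ` is `ℂ` with the `O`-module structure given by `γ`);
equivalently, the left ideal `ι(ker γ)·A` of `A` is proper. -/
theorem statement1 (O A : Type) [CommRing O] [Ring A]
    [HopfAlgebra ℂ O] [HopfAlgebra ℂ A]
    (ι : O →ₐc[ℂ] A) (hι : Function.Injective ι)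
    (γ : O →ₐ[ℂ] ℂ) :
    (letI : Module O A := Module.compHom A (ι : O →ₐ[ℂ] A).toRingHom
     letI : Module O ℂ := Module.compHom ℂ γ.toRingHom
     Nontrivial (ℂ ⊗[O] A)) ∧
    Submodule.span ℂ {z : A | ∃ o : O, ∃ x : A, γ o = 0 ∧ z = ι o * x} ≠ ⊤ := by
  obtain ⟨p, hp, f, hf, hf'⟩ := exists_semiinvariant ι hι γ
  constructor
  · obtain ⟨φ, hφ⟩ := Module.Projective.exists_dual_eq_one ℂ (one_ne_zero (α := p.ResidueField))
    let _ : Module O A := Module.compHom A (ι : O →ₐ[ℂ] A).toRingHom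
    let _ : Module O ℂ := Module.compHom ℂ γ.toRingHom
    have : IsScalarTower O ℂ ℂ := ⟨fun o x y ↦ mul_assoc (γ o) x y⟩
    let g : A →ₗ[O] ℂ :=
      { toFun := fun x ↦ φ (f x)
        map_add' := fun x y ↦ by simp
        map_smul' := fun o x ↦ by
          change φ (f (ι o * x)) = γ o * φ (f x)
          rw [hf', ← Algebra.smul_def, map_smul, smul_eq_mul] }
    have hg : g 1 ≠ 0 := by
      change φ (f 1) ≠ 0
      rw [hf, hφ]
      exact one_ne_zero
    exact TensorProduct.nontrivial_of_linearMap g hg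
  · intro h
    have hle : Submodule.span ℂ {z : A | ∃ o : O, ∃ x : A, γ o = 0 ∧ z = ι o * x} ≤
        LinearMap.ker f := by
      rw [Submodule.span_le]
      rintro _ ⟨o, x, ho, rfl⟩
      simp [hf', ho]
    have h1 : f 1 = 0 := hle (h ▸ Submodule.mem_top)
    exact one_ne_zero (hf.symm.trans h1)
end

section
/- Let x ∈ A satisfy ρ_A(x) = x ⊗ π(1_A), i.e. x lies in the subspace of right a-coinvariants of A. Then for every left a-comodule M, left multiplication by x on the first tensor factor of A ⊗ M maps the cotensor product (A ⊗ M)^a into itself. -/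
open TensorProduct

noncomputable section

/-- A left comodule structure, over a `ℂ`-coalgebra `C`, on a `ℂ`-vector space `M`:
the coaction `ρ` is coassociative and counital. -/
def IsLeftComodule (C M : Type) [AddCommGroup C] [Module ℂ C] [Coalgebra ℂ C]
    [AddCommGroup M] [Module ℂ M] (ρ : M →ₗ[ℂ] C ⊗[ℂ] M) : Prop :=
  ((TensorProduct.assoc ℂ C C M).toLinearMap ∘ₗ
      TensorProduct.map Coalgebra.comul LinearMap.id ∘ₗ ρ =
    TensorProduct.map LinearMap.id ρ ∘ₗ ρ) ∧
  ((TensorProduct.lid ℂ M).toLinearMap ∘ₗ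
      TensorProduct.map Coalgebra.counit LinearMap.id ∘ₗ ρ = LinearMap.id)

/-- The right `a`-comodule structure `ρ_A := (id_A ⊗ π) ∘ Δ_A` on a bialgebra `A`. -/
def rhoA (A a : Type) [Ring A] [Bialgebra ℂ A] [AddCommGroup a] [Module ℂ a]
    (π : A →ₗ[ℂ] a) : A →ₗ[ℂ] A ⊗[ℂ] a :=
  TensorProduct.map LinearMap.id π ∘ₗ Coalgebra.comul

/-- The cotensor product `(A ⊗ M)^a`: the subspace of `w ∈ A ⊗ M` with
`(ρ_A ⊗ id_M)(w) = (id_A ⊗ ρ_M)(w)` in `A ⊗ a ⊗ M`. -/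
def cotensor (A a M : Type) [Ring A] [Bialgebra ℂ A]
    [AddCommGroup a] [Module ℂ a] [AddCommGroup M] [Module ℂ M]
    (π : A →ₗ[ℂ] a) (ρM : M →ₗ[ℂ] a ⊗[ℂ] M) : Submodule ℂ (A ⊗[ℂ] M) :=
  LinearMap.ker
    ((TensorProduct.assoc ℂ A a M).toLinearMap ∘ₗ
        TensorProduct.map (rhoA A a π) LinearMap.id -
      TensorProduct.map LinearMap.id ρM)

/-- If `π (y * z)` depends on `y` only through `π y`, then `id ⊗ π` turns multiplication in
`A ⊗ A` into the action of `A ⊗ A` on `A ⊗ a`. -/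
theorem map_id_mul_eq_map₂ {A a : Type} [Ring A] [Algebra ℂ A] [AddCommGroup a] [Module ℂ a]
    (ract : a →ₗ[ℂ] A →ₗ[ℂ] a) (π : A →ₗ[ℂ] a) (hπ : ∀ y z : A, π (y * z) = ract (π y) z)
    (u v : A ⊗[ℂ] A) :
    TensorProduct.map LinearMap.id π (u * v) =
      TensorProduct.map₂ (LinearMap.mul ℂ A) ract (TensorProduct.map LinearMap.id π u) v := by
  induction u with
  | zero => simp
  | add u₁ u₂ h₁ h₂ => simp only [add_mul, map_add, LinearMap.add_apply, h₁, h₂]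
  | tmul p q =>
    induction v with
    | zero => simp
    | add v₁ v₂ h₁ h₂ => simp only [mul_add, map_add, h₁, h₂]
    | tmul r s => simp [hπ]

/-- The coaction `rhoA` commutes with left multiplication by a coinvariant element. -/
theorem rhoA_comp_mulLeft {A a : Type} [Ring A] [Bialgebra ℂ A] [AddCommGroup a] [Module ℂ a]
    (ract : a →ₗ[ℂ] A →ₗ[ℂ] a) (π : A →ₗ[ℂ] a) (hπ : ∀ y z : A, π (y * z) = ract (π y) z)
    {x : A} (hx : rhoA A a π x = x ⊗ₜ[ℂ] π 1) :
    rhoA A a π ∘ₗ LinearMap.mulLeft ℂ x =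
      TensorProduct.map (LinearMap.mulLeft ℂ x) LinearMap.id ∘ₗ rhoA A a π := by
  have key : TensorProduct.map₂ (LinearMap.mul ℂ A) ract (x ⊗ₜ[ℂ] π 1) =
      TensorProduct.map (LinearMap.mulLeft ℂ x) LinearMap.id ∘ₗ
        TensorProduct.map LinearMap.id π := by
    ext r s
    simp [← hπ]
  ext y
  have hx' : TensorProduct.map LinearMap.id π (Coalgebra.comul (R := ℂ) x) = x ⊗ₜ[ℂ] π 1 := hx
  simp only [rhoA, LinearMap.comp_apply, LinearMap.mulLeft_apply, Bialgebra.comul_mul]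
  rw [map_id_mul_eq_map₂ ract π hπ, hx', key, LinearMap.comp_apply]

/-- Let `A` be a bialgebra over `ℂ`, `a` a coalgebra equipped with a right
`A`-module structure `ract`, and `π : A → a` a surjective coalgebra homomorphism which is also
a homomorphism of right `A`-modules (`A` acting on itself by right multiplication).  Let
`x ∈ A` satisfy `ρ_A(x) = x ⊗ π(1)`, i.e. `x` lies in the subspace of right `a`-coinvariants
of `A`.  Then for every left `a`-comodule `M`, left multiplication by `x` on the first tensor
factor of `A ⊗ M` maps the cotensor product `(A ⊗ M)^a` into itself. -/
theorem statement3 (A a : Type) [Ring A] [Bialgebra ℂ A]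
    [AddCommGroup a] [Module ℂ a] [Coalgebra ℂ a]
    (ract : a →ₗ[ℂ] A →ₗ[ℂ] a)
    (hract_one : ∀ u : a, ract u 1 = u)
    (hract_mul : ∀ (u : a) (y z : A), ract u (y * z) = ract (ract u y) z)
    (π : A →ₗc[ℂ] a)
    (hπ_surj : Function.Surjective π)
    (hπ_rmod : ∀ y z : A, π (y * z) = ract (π y) z)
    (x : A) (hx : rhoA A a π.toLinearMap x = x ⊗ₜ[ℂ] π 1) :
    ∀ (M : Type) [AddCommGroup M] [Module ℂ M] (ρM : M →ₗ[ℂ] a ⊗[ℂ] M),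
      IsLeftComodule a M ρM →
        ∀ w ∈ cotensor A a M π.toLinearMap ρM,
          TensorProduct.map (LinearMap.mulLeft ℂ x) LinearMap.id w ∈
            cotensor A a M π.toLinearMap ρM := by
  intro M _ _ ρM _ w hw
  have hρ := rhoA_comp_mulLeft ract π.toLinearMap hπ_rmod hx
  have hleft : ((TensorProduct.assoc ℂ A a M).toLinearMap ∘ₗ
        TensorProduct.map (rhoA A a π.toLinearMap) LinearMap.id) ∘ₗ
        TensorProduct.map (LinearMap.mulLeft ℂ x) LinearMap.id =
      TensorProduct.map (LinearMap.mulLeft ℂ x) LinearMap.id ∘ₗ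
        (TensorProduct.assoc ℂ A a M).toLinearMap ∘ₗ
        TensorProduct.map (rhoA A a π.toLinearMap) LinearMap.id := by
    rw [LinearMap.comp_assoc, ← TensorProduct.map_comp, hρ, LinearMap.id_comp,
      ← LinearMap.id_comp (LinearMap.id : M →ₗ[ℂ] M), TensorProduct.map_comp,
      ← LinearMap.comp_assoc, ← LinearMap.comp_assoc]
    congr 1
    ext
    simp
  have hright : TensorProduct.map LinearMap.id ρM ∘ₗ
        TensorProduct.map (LinearMap.mulLeft ℂ x) LinearMap.id =
      TensorProduct.map (LinearMap.mulLeft ℂ x) LinearMap.id ∘ₗ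
        TensorProduct.map LinearMap.id ρM := by
    simp only [← TensorProduct.map_comp, LinearMap.id_comp, LinearMap.comp_id]
  rw [cotensor, LinearMap.mem_ker, LinearMap.sub_apply, sub_eq_zero] at hw ⊢
  rw [← LinearMap.comp_apply, hleft, ← LinearMap.comp_apply (TensorProduct.map LinearMap.id ρM),
    hright, LinearMap.comp_apply, hw, LinearMap.comp_apply]
end
end

section
/- Assume the triple (O, A, a) satisfies conditions (i), (ii), (iii) and that A is faithfully flat as an O-module. Then for every left a-comodule M: left multiplication on the first tensor factor makes (A ⊗ M)^a a left O-module, the ℂ-linear map e : (A ⊗ M)^a → M defined by e(w) = (ε_A ⊗ id_M)(w) is surjective, and its kernel equals ι(m)·(A ⊗ M)^a; consequently e induces an isomorphism ℂ ⊗_O (A ⊗ M)^a ≅ M. -/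
open TensorProduct

noncomputable section

/-- The evaluation `ε_A ⊗ id_M : A ⊗ M → M`. -/
def counitEval (A M : Type) [Ring A] [Bialgebra ℂ A] [AddCommGroup M] [Module ℂ M] :
    A ⊗[ℂ] M →ₗ[ℂ] M :=
  (TensorProduct.lid ℂ M).toLinearMap ∘ₗ TensorProduct.map Coalgebra.counit LinearMap.id

/-- The antipode of a commutative Hopf algebra is an involution. -/
theorem antipode_antipode_of_comm {R H : Type*} [CommRing R] [CommRing H] [HopfAlgebra R H]
    (h : H) : HopfAlgebra.antipode R (HopfAlgebra.antipode R h) = h :=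
  congrArg (fun f => f.ofConv h) (inv_inv (WithConv.toConv (AlgHom.id R H)))

/-- If a flat module `A` carries a functional `εA` which is equivariant along an augmentation `εO`,
then an element of `A ⊗ P` which dies in `A ⊗[O] N` has its contraction along `εA` in
`ker εO • P`. -/
theorem lid_rTensor_mem_ker_smul_top {k O A N : Type*} [CommRing k] [CommRing O] [Algebra k O]
    [AddCommGroup A] [Module k A] [Module O A] [IsScalarTower k O A] [Module.Flat O A]
    [AddCommGroup N] [Module k N] [Module O N] [IsScalarTower k O N]
    (εO : O →ₐ[k] k) (εA : A →ₗ[k] k) (hε : ∀ o x, εA (o • x) = εO o * εA x)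
    (P : Submodule O N) (t : A ⊗[k] P)
    (ht : TensorProduct.mapOfCompatibleSMul O k k A N
      ((P.subtype.restrictScalars k).lTensor A t) = 0) :
    TensorProduct.lid k P (εA.rTensor P t) ∈ RingHom.ker εO • (⊤ : Submodule O P) := by
  have hnat : ∀ z : A ⊗[k] P, TensorProduct.mapOfCompatibleSMul O k k A N
      ((P.subtype.restrictScalars k).lTensor A z) =
      P.subtype.lTensor A (TensorProduct.mapOfCompatibleSMul O k k A P z) := by
    intro z
    induction z with
    | zero => simp
    | tmul x y => simp
    | add x y hx hy => simp only [map_add, hx, hy]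
  have h0 : TensorProduct.mapOfCompatibleSMul O k k A P t = 0 :=
    Module.Flat.lTensor_preserves_injective_linearMap (M := A) P.subtype P.injective_subtype
      (by rw [← hnat, ht, map_zero])
  let I := RingHom.ker εO • (⊤ : Submodule O P)
  let f : A →+ P →+ P ⧸ I :=
    AddMonoidHom.mk' (fun x => AddMonoidHom.mk' (fun p => I.mkQ (εA x • p))
      (fun p q => by rw [smul_add, map_add]))
      (fun x y => by ext p; simp only [map_add, add_smul]; rfl)
  have hf : ∀ (o : O) (x : A) (p : P), f (o • x) p = f x (o • p) := by
    intro o x p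
    change I.mkQ (εA (o • x) • p) = I.mkQ (εA x • o • p)
    rw [← sub_eq_zero, ← map_sub, Submodule.mkQ_apply, Submodule.Quotient.mk_eq_zero]
    have : εA (o • x) • p - εA x • o • p =
        (algebraMap k O (εO o) - o) • (εA x • p) := by
      rw [hε, sub_smul, algebraMap_smul, mul_smul, smul_comm (εA x) o p]
    rw [this]
    refine Submodule.smul_mem_smul ?_ trivial
    simp [RingHom.mem_ker]
  have hβ : ∀ z : A ⊗[k] P, TensorProduct.liftAddHom f hf
      (TensorProduct.mapOfCompatibleSMul O k k A P z) =
      I.mkQ (TensorProduct.lid k P (εA.rTensor P z)) := by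
    intro z
    induction z with
    | zero => simp
    | tmul x y => simp [f]
    | add x y hx hy => simp only [map_add, hx, hy]
  have := hβ t
  rw [h0, map_zero, eq_comm, Submodule.mkQ_apply, Submodule.Quotient.mk_eq_zero] at this
  exact this

/-- The left coaction `Δ_A ⊗ id : A ⊗ W → A ⊗ (A ⊗ W)` of `A` on `A ⊗ W`. -/
def leftCoaction (A W : Type*) [AddCommGroup A] [Module ℂ A] [Coalgebra ℂ A]
    [AddCommGroup W] [Module ℂ W] : A ⊗[ℂ] W →ₗ[ℂ] A ⊗[ℂ] (A ⊗[ℂ] W) :=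
  (TensorProduct.assoc ℂ A A W).toLinearMap ∘ₗ Coalgebra.comul.rTensor W

theorem leftCoaction_tmul {A W : Type*} [AddCommGroup A] [Module ℂ A] [Coalgebra ℂ A]
    [AddCommGroup W] [Module ℂ W] {κ : Type*} {x : A} (r : Coalgebra.Repr ℂ x κ) (w : W) :
    leftCoaction A W (x ⊗ₜ w) = ∑ i ∈ r.index, r.left i ⊗ₜ (r.right i ⊗ₜ w) := by
  simp [leftCoaction, ← r.eq, TensorProduct.sum_tmul]

theorem lid_rTensor_counit_leftCoaction {A W : Type*} [AddCommGroup A] [Module ℂ A]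
    [Coalgebra ℂ A] [AddCommGroup W] [Module ℂ W] (w : A ⊗[ℂ] W) :
    TensorProduct.lid ℂ _ (Coalgebra.counit.rTensor _ (leftCoaction A W w)) = w := by
  induction w with
  | zero => simp
  | add x y hx hy => simp only [map_add, hx, hy]
  | tmul x y =>
    rw [leftCoaction_tmul (Coalgebra.Repr.arbitrary ℂ x)]
    simp only [map_sum, LinearMap.rTensor_tmul, TensorProduct.lid_tmul, TensorProduct.smul_tmul',
      ← TensorProduct.sum_tmul, Coalgebra.sum_counit_smul]

theorem comul_map_mul {O A : Type*} [Ring O] [Ring A] [Bialgebra ℂ O] [Bialgebra ℂ A]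
    (ι : O →ₐc[ℂ] A) {κ κ' : Type*} {o : O} {x : A}
    (r : Coalgebra.Repr ℂ o κ) (s : Coalgebra.Repr ℂ x κ') :
    Coalgebra.comul (R := ℂ) (ι o * x) = ∑ i ∈ r.index, ∑ j ∈ s.index,
      (ι (r.left i) * s.left j) ⊗ₜ (ι (r.right i) * s.right j) := by
  rw [Bialgebra.comul_mul, ← CoalgHomClass.map_comp_comul_apply, ← r.eq, ← s.eq, map_sum,
    Finset.sum_mul_sum]
  simp

/-- Let `n` be an element of an `O`-stable subspace `P` of `A ⊗ W` which is also stable under the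
coaction at `n`. If `A` is flat over `O`, then `n ∈ ι(m)A ⊗ W` implies `n ∈ ι(m)P`. -/
theorem mem_span_of_rTensor_eq_zero {O A a W : Type*} [CommRing O] [Ring A]
    [HopfAlgebra ℂ O] [HopfAlgebra ℂ A] [AddCommGroup a] [Module ℂ a]
    [AddCommGroup W] [Module ℂ W] (ι : O →ₐc[ℂ] A) (π : A →ₗ[ℂ] a)
    (hπ : Function.Surjective π)
    (hker : Submodule.span ℂ {z : A | ∃ o : O, ∃ x : A,
        Coalgebra.counit (R := ℂ) o = 0 ∧ z = ι o * x} = LinearMap.ker π)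
    (hflat : letI : Module O A := Module.compHom A (ι : O →ₐ[ℂ] A).toRingHom
      Module.Flat O A)
    (P : Submodule ℂ (A ⊗[ℂ] W))
    (hP : ∀ (o : O), ∀ w ∈ P, (LinearMap.mulLeft ℂ (ι o)).rTensor W w ∈ P)
    (n : A ⊗[ℂ] W) (t : A ⊗[ℂ] P) (ht : leftCoaction A W n = P.subtype.lTensor A t)
    (hn : π.rTensor W n = 0) :
    n ∈ Submodule.span ℂ {z : A ⊗[ℂ] W | ∃ o : O, ∃ w ∈ P,
        Coalgebra.counit (R := ℂ) o = 0 ∧ z = (LinearMap.mulLeft ℂ (ι o)).rTensor W w} := by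
  let φ : O →ₐ[ℂ] Module.End ℂ (A ⊗[ℂ] W) :=
    (Module.End.rTensorAlgHom ℂ A W).comp ((Algebra.lmul ℂ A).comp
      ((ι : O →ₐ[ℂ] A).comp (HopfAlgebra.antipodeAlgHom ℂ O)))
  let _ : Module O A := Module.compHom A (ι : O →ₐ[ℂ] A).toRingHom
  have : Module.Flat O A := hflat
  have : IsScalarTower ℂ O A := ⟨fun c o x => by
    change ι (c • o) * x = c • (ι o * x)
    simp⟩
  let instW : Module O (A ⊗[ℂ] W) := Module.compHom (A ⊗[ℂ] W) φ.toRingHom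
  let _ : SMul O (A ⊗[ℂ] W) := instW.toSMul
  have hsmul : ∀ (o : O) (w : A ⊗[ℂ] W), o • w =
    (LinearMap.mulLeft ℂ (ι (HopfAlgebra.antipode ℂ o))).rTensor W w := by
    intro o w
    change φ o w = _
    rfl
  have : IsScalarTower ℂ O (A ⊗[ℂ] W) := ⟨fun c o x => by
    change φ (c • o) x = c • φ o x
    simp⟩
  let P' : Submodule O (A ⊗[ℂ] W) :=
    { carrier := P
      add_mem' := P.add_mem
      zero_mem' := P.zero_mem
      smul_mem' := fun o w hw => by rw [hsmul]; exact hP _ w hw }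
  let e : P →ₗ[ℂ] P' := Submodule.inclusion (show P ≤ P'.restrictScalars ℂ from le_rfl)
  let q := TensorProduct.mapOfCompatibleSMul O ℂ ℂ A (A ⊗[ℂ] W)
  have hq : ∀ (o : O), Coalgebra.counit (R := ℂ) o = 0 → ∀ (x : A) (w : W),
      q (leftCoaction A W ((ι o * x) ⊗ₜ w)) = 0 := by
    intro o ho x w
    let r := Coalgebra.Repr.arbitrary ℂ o
    let s := Coalgebra.Repr.arbitrary ℂ x
    have hterm : ∀ (o₁ o₂ : O) (x₁ x₂ : A), q ((ι o₁ * x₁) ⊗ₜ ((ι o₂ * x₂) ⊗ₜ w)) =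
        (o₁ * HopfAlgebra.antipode ℂ o₂) • (x₁ ⊗ₜ[O] (x₂ ⊗ₜ[ℂ] w)) := by
      intro o₁ o₂ x₁ x₂
      have h₁ : ι o₁ * x₁ = o₁ • x₁ := rfl
      have h₂ : (ι o₂ * x₂) ⊗ₜ[ℂ] w = HopfAlgebra.antipode ℂ o₂ • (x₂ ⊗ₜ[ℂ] w) := by
        rw [hsmul, antipode_antipode_of_comm]
        rfl
      rw [h₁, h₂, TensorProduct.mapOfCompatibleSMul_tmul]
      exact TensorProduct.smul_tmul_smul o₁ _ x₁ _
    rw [leftCoaction, LinearMap.comp_apply, LinearMap.rTensor_tmul, comul_map_mul ι r s]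
    simp only [TensorProduct.sum_tmul, map_sum, LinearEquiv.coe_coe, TensorProduct.assoc_tmul,
      hterm]
    rw [Finset.sum_comm]
    simp only [← Finset.sum_smul, HopfAlgebra.sum_mul_antipode_eq_algebraMap_counit r, ho,
      map_zero, zero_smul, Finset.sum_const_zero]
  have hq' : ∀ x ∈ Submodule.span ℂ {z : A | ∃ o : O, ∃ x : A,
      Coalgebra.counit (R := ℂ) o = 0 ∧ z = ι o * x}, ∀ w : W,
      q (leftCoaction A W (x ⊗ₜ w)) = 0 := by
    intro x hx w
    induction hx using Submodule.span_induction with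
    | mem x h =>
      obtain ⟨o, x, ho, rfl⟩ := h
      exact hq o ho x w
    | zero => simp
    | add x y _ _ hx hy => simp only [TensorProduct.add_tmul, map_add, hx, hy, add_zero]
    | smul c x _ hx => simp only [← TensorProduct.smul_tmul', map_smul, hx, smul_zero]
  have hqn : q (leftCoaction A W n) = 0 := by
    have hex : Function.Exact ((LinearMap.ker π).subtype.rTensor W) (π.rTensor W) :=
      rTensor_exact W π.exact_subtype_ker_map hπ
    obtain ⟨y, rfl⟩ := (hex n).1 hn
    clear ht hn
    induction y with
    | zero => simp
    | add x y hx hy => simp only [map_add, hx, hy, add_zero]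
    | tmul x w =>
      exact hq' x (by rw [hker]; exact x.2) w
  have hsub : ∀ z : A ⊗[ℂ] P, (P'.subtype.restrictScalars ℂ).lTensor A (e.lTensor A z) =
      P.subtype.lTensor A z := by
    intro z
    rw [← LinearMap.lTensor_comp_apply]
    rfl
  have key := lid_rTensor_mem_ker_smul_top (Bialgebra.counitAlgHom ℂ O)
    (Coalgebra.counit (R := ℂ) (A := A)) (fun o x => by
      change Coalgebra.counit (ι o * x) = _
      simp) P' (e.lTensor A t) (by rw [hsub, ← ht]; exact hqn)
  have hval : ∀ z : A ⊗[ℂ] P, ((TensorProduct.lid ℂ P'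
      (Coalgebra.counit.rTensor P' (e.lTensor A z)) : P') : A ⊗[ℂ] W) =
      TensorProduct.lid ℂ _ (Coalgebra.counit.rTensor _ (P.subtype.lTensor A z)) := by
    intro z
    induction z with
    | zero => simp
    | tmul x y => simp; rfl
    | add x y hx hy => simp only [map_add, Submodule.coe_add, hx, hy]
  rw [← lid_rTensor_counit_leftCoaction n, ht, ← hval]
  refine Submodule.smul_induction_on (p := fun x : P' => (x : A ⊗[ℂ] W) ∈ Submodule.span ℂ _)
    key ?_ ?_
  · intro o ho p _
    refine Submodule.subset_span ⟨HopfAlgebra.antipode ℂ o, p, p.2, ?_, hsmul o p⟩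
    rw [HopfAlgebra.counit_antipode]
    exact ho
  · intro x y hx hy
    exact Submodule.add_mem _ hx hy

section Cotensor

variable {A a M : Type} [Ring A] [Bialgebra ℂ A] [AddCommGroup a] [Module ℂ a]
  [AddCommGroup M] [Module ℂ M]

/-- The linear map `ρ_A ⊗ id - id ⊗ ρ_M` whose kernel is the cotensor product. -/
def cotensorMap (π : A →ₗ[ℂ] a) (ρM : M →ₗ[ℂ] a ⊗[ℂ] M) : A ⊗[ℂ] M →ₗ[ℂ] A ⊗[ℂ] (a ⊗[ℂ] M) :=
  (TensorProduct.assoc ℂ A a M).toLinearMap ∘ₗ TensorProduct.map (rhoA A a π) LinearMap.id -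
    TensorProduct.map LinearMap.id ρM

theorem cotensorMap_tmul (π : A →ₗ[ℂ] a) (ρM : M →ₗ[ℂ] a ⊗[ℂ] M) {κ : Type*} {x : A}
    (r : Coalgebra.Repr ℂ x κ) (m : M) :
    cotensorMap π ρM (x ⊗ₜ m) =
      ∑ i ∈ r.index, r.left i ⊗ₜ (π (r.right i) ⊗ₜ m) - x ⊗ₜ ρM m := by
  simp [cotensorMap, rhoA, ← r.eq, TensorProduct.sum_tmul]

theorem cotensorMap_mulLeft {O : Type*} [Ring O] [Bialgebra ℂ O] (ι : O →ₐc[ℂ] A)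
    (π : A →ₗ[ℂ] a)
    (hπι : ∀ (o : O) (x : A), π (ι o * x) = Coalgebra.counit (R := ℂ) o • π x)
    (ρM : M →ₗ[ℂ] a ⊗[ℂ] M) (o : O) (w : A ⊗[ℂ] M) :
    cotensorMap π ρM ((LinearMap.mulLeft ℂ (ι o)).rTensor M w) =
      (LinearMap.mulLeft ℂ (ι o)).rTensor (a ⊗[ℂ] M) (cotensorMap π ρM w) := by
  induction w with
  | zero => simp
  | add x y hx hy => simp only [map_add, hx, hy]
  | tmul x m =>
    let r := Coalgebra.Repr.arbitrary ℂ o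
    let s := Coalgebra.Repr.arbitrary ℂ x
    have hr : ∑ i ∈ r.index, Coalgebra.counit (R := ℂ) (r.right i) • r.left i = o := by
      have h := congrArg (TensorProduct.rid ℂ O) (Coalgebra.sum_tmul_counit_eq r)
      simpa only [map_sum, TensorProduct.rid_tmul, one_smul] using h
    have hρ : rhoA A a π (ι o * x) = (LinearMap.mulLeft ℂ (ι o)).rTensor a (rhoA A a π x) := by
      rw [rhoA, LinearMap.comp_apply, LinearMap.comp_apply, comul_map_mul ι r s, ← s.eq]
      simp only [map_sum, TensorProduct.map_tmul, LinearMap.id_apply, hπι,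
        LinearMap.rTensor_tmul, LinearMap.mulLeft_apply]
      rw [Finset.sum_comm]
      refine Finset.sum_congr rfl fun j _ => ?_
      conv_rhs => rw [← hr]
      simp only [map_sum, map_smul, Finset.sum_mul, TensorProduct.sum_tmul, smul_mul_assoc,
        TensorProduct.smul_tmul]
    have hnat : ∀ z : A ⊗[ℂ] a, TensorProduct.assoc ℂ A a M
        ((LinearMap.mulLeft ℂ (ι o)).rTensor a z ⊗ₜ m) =
        (LinearMap.mulLeft ℂ (ι o)).rTensor (a ⊗[ℂ] M) (TensorProduct.assoc ℂ A a M (z ⊗ₜ m)) := by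
      intro z
      induction z with
      | zero => simp
      | tmul x y => simp
      | add x y hx hy => simp only [map_add, TensorProduct.add_tmul, hx, hy]
    simp [cotensorMap, hρ, hnat]

theorem leftCoaction_cotensorMap (π : A →ₗ[ℂ] a) (ρM : M →ₗ[ℂ] a ⊗[ℂ] M) (w : A ⊗[ℂ] M) :
    leftCoaction A (a ⊗[ℂ] M) (cotensorMap π ρM w) =
      (cotensorMap π ρM).lTensor A (leftCoaction A M w) := by
  induction w with
  | zero => simp
  | add x y hx hy => simp only [map_add, hx, hy]
  | tmul x m =>
    let r := Coalgebra.Repr.arbitrary ℂ x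
    have hlin : ∀ u : a ⊗[ℂ] M, leftCoaction A (a ⊗[ℂ] M) (x ⊗ₜ u) =
        ∑ i ∈ r.index, r.left i ⊗ₜ (r.right i ⊗ₜ u) := leftCoaction_tmul r
    have hco := congrArg (TensorProduct.map (LinearMap.id (R := ℂ) (M := A))
      (TensorProduct.map (LinearMap.id (R := ℂ) (M := A)) ((TensorProduct.mk ℂ a M).flip m ∘ₗ π)))
      (Coalgebra.sum_tmul_tmul_eq r (fun i => Coalgebra.Repr.arbitrary ℂ (r.left i))
        (fun i => Coalgebra.Repr.arbitrary ℂ (r.right i)))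
    simp only [map_sum, TensorProduct.map_tmul, LinearMap.id_apply, LinearMap.comp_apply,
      LinearMap.flip_apply, TensorProduct.mk_apply] at hco
    rw [cotensorMap_tmul π ρM r, map_sub, hlin, leftCoaction_tmul r]
    simp only [map_sum, LinearMap.lTensor_tmul,
      fun i => cotensorMap_tmul π ρM (Coalgebra.Repr.arbitrary ℂ (r.right i)) m,
      fun i => leftCoaction_tmul (Coalgebra.Repr.arbitrary ℂ (r.left i)) (π (r.right i) ⊗ₜ[ℂ] m),
      TensorProduct.tmul_sub, TensorProduct.tmul_sum, Finset.sum_sub_distrib, hco]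

theorem lid_rTensor_counit_cotensorMap (π : A →ₗ[ℂ] a) (ρM : M →ₗ[ℂ] a ⊗[ℂ] M)
    (w : A ⊗[ℂ] M) :
    TensorProduct.lid ℂ _ (Coalgebra.counit.rTensor _ (cotensorMap π ρM w)) =
      π.rTensor M w - ρM (counitEval A M w) := by
  induction w with
  | zero => simp
  | add x y hx hy => simp only [map_add, hx, hy]; abel
  | tmul x m =>
    let r := Coalgebra.Repr.arbitrary ℂ x
    rw [cotensorMap_tmul π ρM r]
    simp only [map_sub, map_sum, LinearMap.rTensor_tmul, TensorProduct.lid_tmul,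
      TensorProduct.smul_tmul', ← map_smul, ← TensorProduct.sum_tmul]
    rw [← map_sum, Coalgebra.sum_counit_smul]
    simp [counitEval]

theorem rTensor_cotensorMap [Coalgebra ℂ a] (π : A →ₗc[ℂ] a) (ρM : M →ₗ[ℂ] a ⊗[ℂ] M)
    (w : A ⊗[ℂ] M) :
    π.toLinearMap.rTensor (a ⊗[ℂ] M) (cotensorMap π.toLinearMap ρM w) =
      TensorProduct.assoc ℂ a a M
        (TensorProduct.map Coalgebra.comul LinearMap.id (π.toLinearMap.rTensor M w)) -
        TensorProduct.map LinearMap.id ρM (π.toLinearMap.rTensor M w) := by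
  induction w with
  | zero => simp
  | add x y hx hy => simp only [map_add, hx, hy]; abel
  | tmul x m =>
    let r := Coalgebra.Repr.arbitrary ℂ x
    have h : Coalgebra.comul (π.toLinearMap x) =
        TensorProduct.map π.toLinearMap π.toLinearMap (Coalgebra.comul (R := ℂ) x) :=
      (CoalgHomClass.map_comp_comul_apply π x).symm
    rw [cotensorMap_tmul _ ρM r]
    simp only [map_sub, map_sum, LinearMap.rTensor_tmul, TensorProduct.map_tmul, h, ← r.eq,
      TensorProduct.sum_tmul, LinearMap.id_apply, TensorProduct.assoc_tmul]

end Cotensor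

/-- Let `(O, A, a)` be a triple as in the paper: `ι : O → A` an injective
homomorphism of Hopf algebras over `ℂ` with `O` commutative, `a` a coalgebra with a right
`A`-module structure `ract`, `π : A → a` a surjective coalgebra homomorphism and
homomorphism of right `A`-modules, satisfying conditions (i), (ii), (iii); assume moreover
that `A` is faithfully flat as an `O`-module.  Then for every left `a`-comodule `M`:
left multiplication on the first tensor factor makes `(A ⊗ M)^a` a left `O`-module;
the map `e = (ε_A ⊗ id_M) : (A ⊗ M)^a → M` is surjective; and its kernel equals
`ι(m)·(A ⊗ M)^a` — consequently `e` induces an isomorphism `ℂ ⊗_O (A ⊗ M)^a ≅ M`. -/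
theorem statement6 (O A a : Type) [CommRing O] [Ring A]
    [HopfAlgebra ℂ O] [HopfAlgebra ℂ A]
    [AddCommGroup a] [Module ℂ a] [Coalgebra ℂ a]
    (ι : O →ₐc[ℂ] A) (hι : Function.Injective ι)
    (ract : a →ₗ[ℂ] A →ₗ[ℂ] a)
    (hract_one : ∀ u : a, ract u 1 = u)
    (hract_mul : ∀ (u : a) (y z : A), ract u (y * z) = ract (ract u y) z)
    (π : A →ₗc[ℂ] a)
    (hπ_surj : Function.Surjective π)
    (hπ_rmod : ∀ y z : A, π (y * z) = ract (π y) z)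
    (cond_i : ∀ o : O, π (ι o) = Coalgebra.counit (R := ℂ) o • π 1)
    (cond_ii : ∀ x : A, rhoA A a π.toLinearMap x = x ⊗ₜ[ℂ] π 1 ↔ x ∈ Set.range ι)
    (cond_iii : Submodule.span ℂ {z : A | ∃ o : O, ∃ x : A,
        Coalgebra.counit (R := ℂ) o = 0 ∧ z = ι o * x} = LinearMap.ker π.toLinearMap)
    (hff : letI : Module O A := Module.compHom A (ι : O →ₐ[ℂ] A).toRingHom
      Module.Flat O A ∧
        ∀ (M : Type) [AddCommGroup M] [Module O M],
          Subsingleton (M ⊗[O] A) → Subsingleton M)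
    (M : Type) [AddCommGroup M] [Module ℂ M]
    (ρM : M →ₗ[ℂ] a ⊗[ℂ] M) (hρM : IsLeftComodule a M ρM) :
    (∀ (o : O), ∀ w ∈ cotensor A a M π.toLinearMap ρM,
        TensorProduct.map (LinearMap.mulLeft ℂ (ι o)) LinearMap.id w ∈
          cotensor A a M π.toLinearMap ρM) ∧
    (∀ m : M, ∃ w ∈ cotensor A a M π.toLinearMap ρM, counitEval A M w = m) ∧
    (LinearMap.ker (counitEval A M) ⊓ cotensor A a M π.toLinearMap ρM =
      Submodule.span ℂ {z : A ⊗[ℂ] M | ∃ o : O, ∃ w ∈ cotensor A a M π.toLinearMap ρM,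
        Coalgebra.counit (R := ℂ) o = 0 ∧
          z = TensorProduct.map (LinearMap.mulLeft ℂ (ι o)) LinearMap.id w}) := by
  have hπι : ∀ (o : O) (x : A),
      π.toLinearMap (ι o * x) = Coalgebra.counit (R := ℂ) o • π.toLinearMap x := by
    intro o x
    change π (ι o * x) = _ • π x
    rw [hπ_rmod, cond_i, map_smul, LinearMap.smul_apply, ← hπ_rmod, one_mul]
  have hstable : ∀ (o : O), ∀ w ∈ cotensor A a M π.toLinearMap ρM,
      (LinearMap.mulLeft ℂ (ι o)).rTensor M w ∈ cotensor A a M π.toLinearMap ρM := by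
    intro o w hw
    change cotensorMap π.toLinearMap ρM _ = 0
    rw [cotensorMap_mulLeft ι _ hπι, show cotensorMap π.toLinearMap ρM w = 0 from hw, map_zero]
  have hρinj : Function.Injective ρM :=
    (Function.LeftInverse.injective (g := (TensorProduct.lid ℂ M).toLinearMap ∘ₗ
      TensorProduct.map Coalgebra.counit LinearMap.id) fun m => LinearMap.congr_fun hρM.2 m)
  have hρe : ∀ w ∈ cotensor A a M π.toLinearMap ρM,
      ρM (counitEval A M w) = π.toLinearMap.rTensor M w := by
    intro w hw
    have h := lid_rTensor_counit_cotensorMap π.toLinearMap ρM w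
    rw [show cotensorMap π.toLinearMap ρM w = 0 from hw, map_zero, map_zero] at h
    exact (sub_eq_zero.1 h.symm).symm
  refine ⟨hstable, fun m => ?_, le_antisymm ?_ ?_⟩
  · obtain ⟨w₀, hw₀⟩ := LinearMap.rTensor_surjective M
      (show Function.Surjective π.toLinearMap from hπ_surj) (ρM m)
    have hz : π.toLinearMap.rTensor (a ⊗[ℂ] M) (cotensorMap π.toLinearMap ρM w₀) = 0 := by
      rw [rTensor_cotensorMap π ρM, hw₀, sub_eq_zero]
      exact LinearMap.congr_fun hρM.1 m
    have hmem := mem_span_of_rTensor_eq_zero ι π.toLinearMap hπ_surj cond_iii hff.1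
      (LinearMap.range (cotensorMap π.toLinearMap ρM))
      (by
        rintro o _ ⟨w, rfl⟩
        exact ⟨_, cotensorMap_mulLeft ι _ hπι ρM o w⟩)
      (cotensorMap π.toLinearMap ρM w₀)
      ((cotensorMap π.toLinearMap ρM).rangeRestrict.lTensor A (leftCoaction A M w₀))
      (by
        rw [leftCoaction_cotensorMap, ← LinearMap.lTensor_comp_apply]
        rfl) hz
    have hlift : ∀ z ∈ Submodule.span ℂ {z : A ⊗[ℂ] (a ⊗[ℂ] M) | ∃ o : O,
        ∃ w ∈ LinearMap.range (cotensorMap π.toLinearMap ρM),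
          Coalgebra.counit (R := ℂ) o = 0 ∧
            z = (LinearMap.mulLeft ℂ (ι o)).rTensor (a ⊗[ℂ] M) w},
        z ∈ (LinearMap.ker (π.toLinearMap.rTensor M)).map (cotensorMap π.toLinearMap ρM) := by
      intro z hz
      refine Submodule.span_le.2 ?_ hz
      rintro _ ⟨o, _, ⟨w, rfl⟩, ho, rfl⟩
      refine ⟨(LinearMap.mulLeft ℂ (ι o)).rTensor M w, ?_, cotensorMap_mulLeft ι _ hπι ρM o w⟩
      have hcomp : π.toLinearMap ∘ₗ LinearMap.mulLeft ℂ (ι o) = 0 := by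
        ext x
        simpa [ho] using hπι o x
      change π.toLinearMap.rTensor M _ = 0
      rw [← LinearMap.rTensor_comp_apply, hcomp, LinearMap.rTensor_zero, LinearMap.zero_apply]
    obtain ⟨w₁, hw₁, hd⟩ := hlift _ hmem
    have hw : w₀ - w₁ ∈ cotensor A a M π.toLinearMap ρM := by
      change cotensorMap π.toLinearMap ρM (w₀ - w₁) = 0
      rw [map_sub, hd, sub_self]
    refine ⟨w₀ - w₁, hw, hρinj ?_⟩
    rw [hρe _ hw, map_sub, hw₀, show π.toLinearMap.rTensor M w₁ = 0 from hw₁, sub_zero]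
  · rintro w ⟨hw0, hw⟩
    have hex : Function.Exact
        ((LinearMap.ker (cotensorMap π.toLinearMap ρM)).subtype.lTensor A)
        ((cotensorMap π.toLinearMap ρM).lTensor A) :=
      Module.Flat.lTensor_exact A (LinearMap.exact_subtype_ker_map _)
    obtain ⟨t, ht⟩ := (hex (leftCoaction A M w)).1 (by
      rw [← leftCoaction_cotensorMap, show cotensorMap π.toLinearMap ρM w = 0 from hw, map_zero])
    exact mem_span_of_rTensor_eq_zero ι π.toLinearMap hπ_surj cond_iii hff.1
      (cotensor A a M π.toLinearMap ρM) hstable w t ht.symm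
      (by rw [← hρe w hw, show counitEval A M w = 0 from hw0, map_zero])
  · refine Submodule.span_le.2 ?_
    rintro _ ⟨o, w, hw, ho, rfl⟩
    refine ⟨?_, hstable o w hw⟩
    have hcomp : Coalgebra.counit ∘ₗ LinearMap.mulLeft ℂ (ι o) = 0 := by
      ext x
      simp [ho]
    change TensorProduct.lid ℂ M (Coalgebra.counit.rTensor M
      ((LinearMap.mulLeft ℂ (ι o)).rTensor M w)) = 0
    rw [← LinearMap.rTensor_comp_apply, hcomp, LinearMap.rTensor_zero, LinearMap.zero_apply,
      map_zero]
end
end
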